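/- arXiv:2603.16168 — 2 statements merged into one kernel-verified Lean document; each statement's English description precedes it below -/
import Mathlib

section
/- Stability: Suppose Hamiltonians H and H_k, k ∈ ℕ, and boundary functionals σ and σ_k, k ∈ ℕ, all satisfy conditions (A.1)–(A.6), with functions c_H(·) and c_{H_k}(·) from condition (A.4). Assume: (i) ‖c_{H_k}(·) − c_H(·)‖₁ → 0 as k → ∞; (ii) for every compact D ⊂ C and every s ∈ ℝⁿ, max_{y(·)∈D} ∫₀ᵀ |H_k(t,y(·),s) − H(t,y(·),s)| dt → 0 and max_{y(·)∈D} |σ_k(y(·)) − σ(y(·))| → 0 as k → ∞; (iii) for every k ∈ ℕ there exists a minimax solution φ_k of the Cauchy problem with Hamiltonian H_k and boundary functional σ_k. Then the Cauchy problem with Hamiltonian H and boundary functional σ has at least one minimax solution φ, and for every compact D ⊂ C, max_{(t,x(·))∈[0,T]×D} |φ_k(t,x(·)) − φ(t,x(·))| → 0 as k → ∞. -/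
open MeasureTheory Set Filter Topology

noncomputable section

attribute [local instance] Classical.propDecidable

/-- Euclidean space `ℝⁿ`. -/
abbrev Euc (n : ℕ) : Type := EuclideanSpace ℝ (Fin n)

/-- The path space `C([-h,T], ℝⁿ)` with the sup norm. -/
abbrev PathSp (n : ℕ) (h T : ℝ) : Type := ContinuousMap (Set.Icc (-h) T) (Euc n)

/-- The time map `τ ↦ τ ∧ t` on `[-h,T]` (for `t ∈ [0,T]`, `h ≥ 0`, this is `min τ t`). -/
def stopTime (h T t : ℝ) (τ : Set.Icc (-h) T) : Set.Icc (-h) T :=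
  ⟨max (-h) (min τ.1 t), le_max_left _ _,
    max_le (le_trans τ.2.1 τ.2.2) (le_trans (min_le_left _ _) τ.2.2)⟩

lemma continuous_stopTime (h T t : ℝ) : Continuous (stopTime h T t) :=
  Continuous.subtype_mk
    (continuous_const.max (continuous_subtype_val.min continuous_const)) _

/-- The stopped path `x(· ∧ t)`. -/
def stopPath {n : ℕ} {h T : ℝ} (t : ℝ) (x : PathSp n h T) : PathSp n h T :=
  x.comp ⟨stopTime h T t, continuous_stopTime h T t⟩

/-- Evaluation of a path at a real time (times outside `[-h,T]` are projected). -/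
def evalP {n : ℕ} {h T : ℝ} (x : PathSp n h T) (τ : ℝ) : Euc n :=
  if hc : -h ≤ T then x (Set.projIcc (-h) T hc τ) else 0

/-- The `L¹([0,T])` distance between two functions. -/
def L1dist (T : ℝ) (c₁ c₂ : ℝ → ℝ) : ℝ := ∫ τ in Set.Icc (0:ℝ) T, |c₁ τ - c₂ τ|

/-- A nonnegative function in `L¹([0,T],ℝ)`. -/
def IntegNonneg (T : ℝ) (c : ℝ → ℝ) : Prop :=
  IntegrableOn c (Set.Icc 0 T) volume ∧ ∀ τ ∈ Set.Icc (0:ℝ) T, 0 ≤ c τ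

/-- `AC(t,x(·))`, presented with an explicit derivative witness: pairs `(y, y')`
such that `y(·∧t) = x(·∧t)`, `y'` is integrable on `[t,T]`, and `y` is the
indefinite integral of `y'` on `[t,T]` (i.e. `y|_{[t,T]}` is absolutely continuous
with a.e. derivative `y'`). -/
def ACPair {n : ℕ} {h T : ℝ} (t : ℝ) (x : PathSp n h T) :
    Set (PathSp n h T × (ℝ → Euc n)) :=
  {p | stopPath t p.1 = stopPath t x ∧ IntervalIntegrable p.2 volume t T ∧
       ∀ τ ∈ Set.Icc t T, evalP p.1 τ = evalP p.1 t + ∫ ξ in t..τ, p.2 ξ}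

/-- The set `AC(t,x(·))`. -/
def ACSet {n : ℕ} {h T : ℝ} (t : ℝ) (x : PathSp n h T) : Set (PathSp n h T) :=
  {y | ∃ y', (y, y') ∈ ACPair t x}

/-- Pairs `(y, y')` with `y ∈ Y(t,x(·);c(·))` and derivative witness `y'`. -/
def YPair {n : ℕ} {h T : ℝ} (t : ℝ) (x : PathSp n h T) (c : ℝ → ℝ) :
    Set (PathSp n h T × (ℝ → Euc n)) :=
  {p | p ∈ ACPair t x ∧
       ∀ᵐ τ ∂(volume.restrict (Set.Icc t T)), ‖p.2 τ‖ ≤ c τ * (1 + ‖stopPath τ p.1‖)}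

/-- The set `Y(t,x(·);c(·))`. -/
def YSet {n : ℕ} {h T : ℝ} (t : ℝ) (x : PathSp n h T) (c : ℝ → ℝ) :
    Set (PathSp n h T) :=
  {y | ∃ y', (y, y') ∈ YPair t x c}

/-- Condition (A.1): measurability in `t` on `[0,T]`. -/
def CondA1 {n : ℕ} {h T : ℝ} (H : ℝ → PathSp n h T → Euc n → ℝ) : Prop :=
  ∀ (x : PathSp n h T) (s : Euc n),
    Measurable ((Set.Icc (0:ℝ) T).restrict (fun t => H t x s))

/-- Condition (A.2): continuity in `(x,s)` for a.e. `t`. -/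
def CondA2 {n : ℕ} {h T : ℝ} (H : ℝ → PathSp n h T → Euc n → ℝ) : Prop :=
  ∃ E : Set ℝ, E ⊆ Set.Icc 0 T ∧ volume E = ENNReal.ofReal T ∧
    ∀ t ∈ E, Continuous (fun p : PathSp n h T × Euc n => H t p.1 p.2)

/-- Condition (A.3) for a given compact set `D` and function `λ_H(·;D)`. -/
def CondA3For {n : ℕ} {h T : ℝ} (H : ℝ → PathSp n h T → Euc n → ℝ)
    (D : Set (PathSp n h T)) (lam : ℝ → ℝ) : Prop :=
  IntegNonneg T lam ∧
  ∀ x₁ ∈ D, ∀ x₂ ∈ D, ∀ s : Euc n,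
    ∃ E : Set ℝ, E ⊆ Set.Icc 0 T ∧ volume E = ENNReal.ofReal T ∧
      ∀ t ∈ E, |H t x₁ s - H t x₂ s| ≤
        lam t * (1 + ‖s‖) * ‖stopPath t x₁ - stopPath t x₂‖

/-- Condition (A.3). -/
def CondA3 {n : ℕ} {h T : ℝ} (H : ℝ → PathSp n h T → Euc n → ℝ) : Prop :=
  ∀ D : Set (PathSp n h T), IsCompact D → ∃ lam : ℝ → ℝ, CondA3For H D lam

/-- Condition (A.4), with the function `c_H(·)` made explicit. -/
def CondA4 {n : ℕ} {h T : ℝ} (H : ℝ → PathSp n h T → Euc n → ℝ) (cH : ℝ → ℝ) : Prop :=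
  IntegNonneg T cH ∧
  ∃ E : Set ℝ, E ⊆ Set.Icc 0 T ∧ volume E = ENNReal.ofReal T ∧
    ∀ t ∈ E, ∀ (x : PathSp n h T) (s₁ s₂ : Euc n),
      |H t x s₁ - H t x s₂| ≤ cH t * (1 + ‖stopPath t x‖) * ‖s₁ - s₂‖

/-- Condition (A.5) for a given compact set `D` and function `m_H(·;D)`. -/
def CondA5For {n : ℕ} {h T : ℝ} (H : ℝ → PathSp n h T → Euc n → ℝ)
    (D : Set (PathSp n h T)) (m : ℝ → ℝ) : Prop :=
  IntegNonneg T m ∧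
  ∀ x ∈ D, ∃ E : Set ℝ, E ⊆ Set.Icc 0 T ∧ volume E = ENNReal.ofReal T ∧
    ∀ t ∈ E, |H t x (0 : Euc n)| ≤ m t

/-- Condition (A.5). -/
def CondA5 {n : ℕ} {h T : ℝ} (H : ℝ → PathSp n h T → Euc n → ℝ) : Prop :=
  ∀ D : Set (PathSp n h T), IsCompact D → ∃ m : ℝ → ℝ, CondA5For H D m

/-- Conditions (A.1)–(A.5), with the function `c_H(·)` from (A.4) made explicit. -/
def CondA {n : ℕ} {h T : ℝ} (H : ℝ → PathSp n h T → Euc n → ℝ) (cH : ℝ → ℝ) : Prop :=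
  CondA1 H ∧ CondA2 H ∧ CondA3 H ∧ CondA4 H cH ∧ CondA5 H

/-- A functional `φ` on `[0,T] × C` is non-anticipative. -/
def NonAnticipative {n : ℕ} {h T : ℝ} (φ : ℝ → PathSp n h T → ℝ) : Prop :=
  ∀ t ∈ Set.Icc (0:ℝ) T, ∀ x : PathSp n h T, φ t x = φ t (stopPath t x)

/-- Property (U) from the definition of an upper solution. -/
def PropU {n : ℕ} {h T : ℝ} (H : ℝ → PathSp n h T → Euc n → ℝ) (cH : ℝ → ℝ)
    (φ : ℝ → PathSp n h T → ℝ) : Prop :=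
  ∀ t ∈ Set.Ico (0:ℝ) T, ∀ x : PathSp n h T, ∀ s : Euc n, ∀ τ ∈ Set.Ioc t T,
    ∃ p ∈ YPair t x cH,
      φ τ p.1 - ∫ ξ in t..τ, (@inner ℝ _ _ s (p.2 ξ) - H ξ p.1 s) ≤ φ t x

/-- Property (L) from the definition of a lower solution. -/
def PropL {n : ℕ} {h T : ℝ} (H : ℝ → PathSp n h T → Euc n → ℝ) (cH : ℝ → ℝ)
    (φ : ℝ → PathSp n h T → ℝ) : Prop :=
  ∀ t ∈ Set.Ico (0:ℝ) T, ∀ x : PathSp n h T, ∀ s : Euc n, ∀ τ ∈ Set.Ioc t T,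
    ∃ p ∈ YPair t x cH,
      φ t x ≤ φ τ p.1 - ∫ ξ in t..τ, (@inner ℝ _ _ s (p.2 ξ) - H ξ p.1 s)

/-- Upper solution of the Cauchy problem for `H` (with `c_H` from (A.4)) and `σ`. -/
def UpperSol {n : ℕ} {h T : ℝ} (H : ℝ → PathSp n h T → Euc n → ℝ) (cH : ℝ → ℝ)
    (σ : PathSp n h T → ℝ) (φ : ℝ → PathSp n h T → ℝ) : Prop :=
  NonAnticipative φ ∧
  LowerSemicontinuousOn (fun p : ℝ × PathSp n h T => φ p.1 p.2)
    (Set.Icc 0 T ×ˢ (Set.univ : Set (PathSp n h T))) ∧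
  (∀ x : PathSp n h T, σ x ≤ φ T x) ∧
  PropU H cH φ

/-- Lower solution of the Cauchy problem for `H` (with `c_H` from (A.4)) and `σ`. -/
def LowerSol {n : ℕ} {h T : ℝ} (H : ℝ → PathSp n h T → Euc n → ℝ) (cH : ℝ → ℝ)
    (σ : PathSp n h T → ℝ) (φ : ℝ → PathSp n h T → ℝ) : Prop :=
  NonAnticipative φ ∧
  UpperSemicontinuousOn (fun p : ℝ × PathSp n h T => φ p.1 p.2)
    (Set.Icc 0 T ×ˢ (Set.univ : Set (PathSp n h T))) ∧
  (∀ x : PathSp n h T, φ T x ≤ σ x) ∧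
  PropL H cH φ

/-- Minimax solution of the Cauchy problem. -/
def MinimaxSol {n : ℕ} {h T : ℝ} (H : ℝ → PathSp n h T → Euc n → ℝ) (cH : ℝ → ℝ)
    (σ : PathSp n h T → ℝ) (φ : ℝ → PathSp n h T → ℝ) : Prop :=
  UpperSol H cH σ φ ∧ LowerSol H cH σ φ

/-- `φ` is ci-differentiable at `(t,x(·))` with ci-derivatives `a = ∂ₜφ(t,x(·))`
and `g = ∇φ(t,x(·))`. -/
def HasCiDeriv {n : ℕ} {h T : ℝ} (φ : ℝ → PathSp n h T → ℝ)
    (t : ℝ) (x : PathSp n h T) (a : ℝ) (g : Euc n) : Prop :=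
  ∀ p ∈ ACPair t x, ∃ o : ℝ → ℝ,
    (∀ τ ∈ Set.Ioc t T,
      φ τ p.1 - φ t x =
        a * (τ - t) + @inner ℝ _ _ g (evalP p.1 τ - evalP x t) + o (τ - t)) ∧
    Tendsto (fun τ => o (τ - t) / (τ - t + ∫ ξ in t..τ, ‖p.2 ξ‖))
      (nhdsWithin t (Set.Ioi t)) (nhds 0)

/-- `φ ∈ Φ`, with the ci-derivatives `Dt = ∂ₜφ`, `Dx = ∇φ` and the full-measure
set `Eφ` of ci-differentiability made explicit. -/
structure IsInPhi {n : ℕ} {h T : ℝ} (φ : ℝ → PathSp n h T → ℝ)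
    (Dt : ℝ → PathSp n h T → ℝ) (Dx : ℝ → PathSp n h T → Euc n)
    (Eφ : Set ℝ) : Prop where
  cont : ContinuousOn (fun p : ℝ × PathSp n h T => φ p.1 p.2)
    (Set.Icc 0 T ×ˢ (Set.univ : Set (PathSp n h T)))
  absCont : ∀ t ∈ Set.Ico (0:ℝ) T, ∀ x : PathSp n h T, ∀ p ∈ ACPair t x,
    ∀ θ ∈ Set.Ioo t T, ∃ g : ℝ → ℝ, IntervalIntegrable g volume t θ ∧
      ∀ τ ∈ Set.Icc t θ, φ τ p.1 = φ t p.1 + ∫ ξ in t..τ, g ξ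
  Esub : Eφ ⊆ Set.Ico 0 T
  Efull : volume Eφ = ENNReal.ofReal T
  ciDiff : ∀ t ∈ Eφ, ∀ x : PathSp n h T, HasCiDeriv φ t x (Dt t x) (Dx t x)
  measD : ∀ x : PathSp n h T, Measurable (Eφ.restrict (fun t => (Dt t x, Dx t x)))
  contD : ∀ t ∈ Eφ, Continuous (fun x : PathSp n h T => (Dt t x, Dx t x))
  bddD : ∀ D : Set (PathSp n h T), IsCompact D → ∀ θ ∈ Set.Ico (0:ℝ) T,
    ∃ m : ℝ → ℝ, (IntegrableOn m (Set.Icc 0 θ) volume ∧ ∀ τ ∈ Set.Icc (0:ℝ) θ, 0 ≤ m τ) ∧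
      ∃ ℓ : ℝ, 0 < ℓ ∧ ∀ t ∈ Eφ ∩ Set.Icc 0 θ, ∀ x ∈ D, |Dt t x| ≤ m t ∧ ‖Dx t x‖ ≤ ℓ

/-- Semiclassical solution of the Cauchy problem (with derivative data). -/
def SemiclassicalSol {n : ℕ} {h T : ℝ} (H : ℝ → PathSp n h T → Euc n → ℝ)
    (σ : PathSp n h T → ℝ) (φ : ℝ → PathSp n h T → ℝ)
    (Dt : ℝ → PathSp n h T → ℝ) (Dx : ℝ → PathSp n h T → Euc n) (Eφ : Set ℝ) : Prop :=
  IsInPhi φ Dt Dx Eφ ∧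
  (∀ t ∈ Eφ, ∀ x : PathSp n h T, Dt t x + H t x (Dx t x) = 0) ∧
  ∀ x : PathSp n h T, φ T x = σ x

/-- The Steklov transform of `H` with respect to the first (time) variable,
with `H` extended by `0` outside `[0,T]`. -/
def steklov {n : ℕ} {h T : ℝ} (H : ℝ → PathSp n h T → Euc n → ℝ) (k : ℕ)
    (t : ℝ) (x : PathSp n h T) (s : Euc n) : ℝ :=
  ((k : ℝ) / 2) * ∫ τ in (t - (k : ℝ)⁻¹)..(t + (k : ℝ)⁻¹),
    (if τ ∈ Set.Icc (0:ℝ) T then H τ (stopPath t x) s else 0)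

/-! ### Differential game definitions -/

/-- Admissible controls with values in `P`. -/
def Ctrl {m : ℕ} (P : Set (Euc m)) : Set (ℝ → Euc m) :=
  {u | Measurable u ∧ ∀ τ, u τ ∈ P}

/-- Non-anticipative strategies mapping `Q`-valued controls to `P`-valued controls
on the interval `[t,T]`. -/
def NAStrat {mP mQ : ℕ} (P : Set (Euc mP)) (Q : Set (Euc mQ)) (t T : ℝ) :
    Set ((ℝ → Euc mQ) → ℝ → Euc mP) :=
  {α | (∀ v ∈ Ctrl Q, α v ∈ Ctrl P) ∧
    ∀ τ ∈ Set.Icc t T, ∀ v ∈ Ctrl Q, ∀ v' ∈ Ctrl Q,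
      (∀ᵐ ξ ∂(volume.restrict (Set.Icc t τ)), v ξ = v' ξ) →
      (∀ᵐ ξ ∂(volume.restrict (Set.Icc t τ)), α v ξ = α v' ξ)}

/-- `(y, y')` is (the derivative-witnessed) motion of the time-delay system
generated by `f` from `(t,x(·))` under controls `u(·)`, `v(·)`. -/
def IsMotion {n : ℕ} {h T : ℝ} {mP mQ : ℕ}
    (f : ℝ → PathSp n h T → Euc mP → Euc mQ → Euc n)
    (t : ℝ) (x : PathSp n h T) (u : ℝ → Euc mP) (v : ℝ → Euc mQ)
    (p : PathSp n h T × (ℝ → Euc n)) : Prop :=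
  p ∈ ACPair t x ∧
  ∀ᵐ τ ∂(volume.restrict (Set.Icc t T)), p.2 τ = f τ p.1 (u τ) (v τ)

/-- The set of values of the cost functional along motions (a singleton when
the motion exists and is unique). -/
def costVals {n : ℕ} {h T : ℝ} {mP mQ : ℕ}
    (f : ℝ → PathSp n h T → Euc mP → Euc mQ → Euc n)
    (χ : ℝ → PathSp n h T → Euc mP → Euc mQ → ℝ) (σ : PathSp n h T → ℝ)
    (t : ℝ) (x : PathSp n h T) (u : ℝ → Euc mP) (v : ℝ → Euc mQ) : Set ℝ :=
  {r | ∃ p : PathSp n h T × (ℝ → Euc n), IsMotion f t x u v p ∧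
        r = σ p.1 - ∫ τ in t..T, χ τ p.1 (u τ) (v τ)}

/-- The lower value `ρ⁻(t,x(·))` of the differential game. -/
def lowerValue {n : ℕ} {h T : ℝ} {mP mQ : ℕ} (P : Set (Euc mP)) (Q : Set (Euc mQ))
    (f : ℝ → PathSp n h T → Euc mP → Euc mQ → Euc n)
    (χ : ℝ → PathSp n h T → Euc mP → Euc mQ → ℝ) (σ : PathSp n h T → ℝ)
    (t : ℝ) (x : PathSp n h T) : ℝ :=
  sInf ((fun α => sSup (⋃ v ∈ Ctrl Q, costVals f χ σ t x (α v) v)) '' NAStrat P Q t T)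

/-- The upper value `ρ⁺(t,x(·))` of the differential game. -/
def upperValue {n : ℕ} {h T : ℝ} {mP mQ : ℕ} (P : Set (Euc mP)) (Q : Set (Euc mQ))
    (f : ℝ → PathSp n h T → Euc mP → Euc mQ → Euc n)
    (χ : ℝ → PathSp n h T → Euc mP → Euc mQ → ℝ) (σ : PathSp n h T → ℝ)
    (t : ℝ) (x : PathSp n h T) : ℝ :=
  sSup ((fun β => sInf (⋃ u ∈ Ctrl P, costVals f χ σ t x u (β u))) '' NAStrat Q P t T)

/-- The lower Hamiltonian `H⁻` (defined via the full-measure set `EC` from (C.2)). -/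
def Hlow {n : ℕ} {h T : ℝ} {mP mQ : ℕ} (P : Set (Euc mP)) (Q : Set (Euc mQ))
    (f : ℝ → PathSp n h T → Euc mP → Euc mQ → Euc n)
    (χ : ℝ → PathSp n h T → Euc mP → Euc mQ → ℝ) (EC : Set ℝ)
    (τ : ℝ) (y : PathSp n h T) (s : Euc n) : ℝ :=
  if τ ∈ EC then
    sSup ((fun v => sInf ((fun u => @inner ℝ _ _ s (f τ y u v) - χ τ y u v) '' P)) '' Q)
  else 0

/-- The upper Hamiltonian `H⁺` (defined via the full-measure set `EC` from (C.2)). -/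
def Hup {n : ℕ} {h T : ℝ} {mP mQ : ℕ} (P : Set (Euc mP)) (Q : Set (Euc mQ))
    (f : ℝ → PathSp n h T → Euc mP → Euc mQ → Euc n)
    (χ : ℝ → PathSp n h T → Euc mP → Euc mQ → ℝ) (EC : Set ℝ)
    (τ : ℝ) (y : PathSp n h T) (s : Euc n) : ℝ :=
  if τ ∈ EC then
    sInf ((fun u => sSup ((fun v => @inner ℝ _ _ s (f τ y u v) - χ τ y u v) '' Q)) '' P)
  else 0

/-- Assumption (C) on the data `(f, χ, σ)` of the differential game, with the
full-measure set `EC` from (C.2) and the function `c_f(·)` from (C.4) explicit. -/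
structure AssumpC {n : ℕ} {h T : ℝ} {mP mQ : ℕ} (P : Set (Euc mP)) (Q : Set (Euc mQ))
    (f : ℝ → PathSp n h T → Euc mP → Euc mQ → Euc n)
    (χ : ℝ → PathSp n h T → Euc mP → Euc mQ → ℝ)
    (σ : PathSp n h T → ℝ) (EC : Set ℝ) (cf : ℝ → ℝ) : Prop where
  meas : ∀ (y : PathSp n h T) (u : Euc mP) (v : Euc mQ),
    Measurable ((Set.Icc (0:ℝ) T).restrict (fun τ => (f τ y u v, χ τ y u v)))
  ECsub : EC ⊆ Set.Icc 0 T
  ECfull : volume EC = ENNReal.ofReal T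
  contOn : ∀ τ ∈ EC, ContinuousOn
    (fun p : PathSp n h T × Euc mP × Euc mQ => (f τ p.1 p.2.1 p.2.2, χ τ p.1 p.2.1 p.2.2))
    ((Set.univ : Set (PathSp n h T)) ×ˢ P ×ˢ Q)
  lip : ∀ D : Set (PathSp n h T), IsCompact D → ∃ lam : ℝ → ℝ, IntegNonneg T lam ∧
    ∃ E : Set ℝ, E ⊆ Set.Icc 0 T ∧ volume E = ENNReal.ofReal T ∧
      ∀ τ ∈ E, ∀ y₁ ∈ D, ∀ y₂ ∈ D, ∀ u ∈ P, ∀ v ∈ Q,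
        ‖f τ y₁ u v - f τ y₂ u v‖ + |χ τ y₁ u v - χ τ y₂ u v| ≤
          lam τ * ‖stopPath τ y₁ - stopPath τ y₂‖
  growth : IntegNonneg T cf ∧
    ∃ E : Set ℝ, E ⊆ Set.Icc 0 T ∧ volume E = ENNReal.ofReal T ∧
      ∀ τ ∈ E, ∀ y : PathSp n h T, ∀ u ∈ P, ∀ v ∈ Q,
        ‖f τ y u v‖ ≤ cf τ * (1 + ‖stopPath τ y‖)
  bdd : ∀ D : Set (PathSp n h T), IsCompact D → ∃ m : ℝ → ℝ, IntegNonneg T m ∧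
    ∃ E : Set ℝ, E ⊆ Set.Icc 0 T ∧ volume E = ENNReal.ofReal T ∧
      ∀ τ ∈ E, ∀ y ∈ D, ∀ u ∈ P, ∀ v ∈ Q, |χ τ y u v| ≤ m τ
  sigC : Continuous σ



section basics
variable {n : ℕ} {h T : ℝ}

lemma evalP_eq (hT : 0 < T) (hh : 0 ≤ h) (x : PathSp n h T) (τ : ℝ) :
    evalP x τ = x (Set.projIcc (-h) T (by linarith) τ) := by
  unfold evalP
  rw [dif_pos (by linarith : -h ≤ T)]

lemma evalP_coe (hT : 0 < T) (hh : 0 ≤ h) (x : PathSp n h T) (τ : Set.Icc (-h) T) :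
    evalP x τ.1 = x τ := by
  rw [evalP_eq hT hh, Set.projIcc_val]

lemma continuous_evalP (hT : 0 < T) (hh : 0 ≤ h) (x : PathSp n h T) :
    Continuous (evalP x) := by
  have : evalP x = fun τ => x (Set.projIcc (-h) T (by linarith) τ) := by
    funext τ; exact evalP_eq hT hh x τ
  rw [this]
  exact x.continuous.comp continuous_projIcc

lemma evalP_sub (hT : 0 < T) (hh : 0 ≤ h) (x y : PathSp n h T) (τ : ℝ) :
    evalP (x - y) τ = evalP x τ - evalP y τ := by
  simp [evalP_eq hT hh]

lemma evalP_stopd (hT : 0 < T) (hh : 0 ≤ h) {t : ℝ} (ht : t ∈ Set.Icc 0 T)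
    (x : PathSp n h T) (τ : ℝ) :
    evalP (stopPath t x) τ = evalP x (min τ t) := by
  rw [evalP_eq hT hh, evalP_eq hT hh]
  unfold stopPath
  simp only [ContinuousMap.comp_apply, ContinuousMap.coe_mk]
  congr 1
  apply Subtype.ext
  simp only [stopTime, Set.projIcc]
  have h1 := ht.1
  have h2 := ht.2
  grind

lemma path_ext (hT : 0 < T) (hh : 0 ≤ h) {x y : PathSp n h T}
    (hxy : ∀ τ, evalP x τ = evalP y τ) : x = y := by
  ext1 τ
  rw [← evalP_coe hT hh, ← evalP_coe hT hh, hxy]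

lemma norm_le_iff_evalP (hT : 0 < T) (hh : 0 ≤ h) {x : PathSp n h T} {r : ℝ} (hr : 0 ≤ r) :
    ‖x‖ ≤ r ↔ ∀ τ, ‖evalP x τ‖ ≤ r := by
  rw [ContinuousMap.norm_le _ hr]
  constructor
  · intro H τ; rw [evalP_eq hT hh]; exact H _
  · intro H τ; rw [← evalP_coe hT hh]; exact H _

lemma norm_evalP_le (hT : 0 < T) (hh : 0 ≤ h) (x : PathSp n h T) (τ : ℝ) :
    ‖evalP x τ‖ ≤ ‖x‖ := (norm_le_iff_evalP hT hh (norm_nonneg x)).1 le_rfl τ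

lemma norm_stop_le_iff (hT : 0 < T) (hh : 0 ≤ h) {t : ℝ} (ht : t ∈ Set.Icc 0 T)
    {x : PathSp n h T} {r : ℝ} (hr : 0 ≤ r) :
    ‖stopPath t x‖ ≤ r ↔ ∀ τ ≤ t, ‖evalP x τ‖ ≤ r := by
  rw [norm_le_iff_evalP hT hh hr]
  constructor
  · intro H τ hτ
    have := H τ
    rwa [evalP_stopd hT hh ht, min_eq_left hτ] at this
  · intro H τ
    rw [evalP_stopd hT hh ht]
    exact H _ (min_le_right _ _)

lemma norm_evalP_le_stopd (hT : 0 < T) (hh : 0 ≤ h) {t : ℝ} (ht : t ∈ Set.Icc 0 T)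
    (x : PathSp n h T) {τ : ℝ} (hτ : τ ≤ t) : ‖evalP x τ‖ ≤ ‖stopPath t x‖ :=
  (norm_stop_le_iff hT hh ht (norm_nonneg _)).1 le_rfl τ hτ

lemma stop_eq_iff (hT : 0 < T) (hh : 0 ≤ h) {t : ℝ} (ht : t ∈ Set.Icc 0 T)
    {x y : PathSp n h T} :
    stopPath t x = stopPath t y ↔ ∀ τ ≤ t, evalP x τ = evalP y τ := by
  constructor
  · intro H τ hτ
    have := congrArg (fun z => evalP z τ) H
    simpa [evalP_stopd hT hh ht, min_eq_left hτ] using this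
  · intro H
    apply path_ext hT hh
    intro τ
    rw [evalP_stopd hT hh ht, evalP_stopd hT hh ht]
    exact H _ (min_le_right _ _)

lemma stop_sub (t : ℝ) (x y : PathSp n h T) :
    stopPath t (x - y) = stopPath t x - stopPath t y := by
  ext1 τ; rfl

lemma stop_eq_mono (hT : 0 < T) (hh : 0 ≤ h) {t t' : ℝ} (ht : t ∈ Set.Icc 0 T)
    (ht' : t' ∈ Set.Icc 0 T) (htt : t ≤ t') {x y : PathSp n h T}
    (H : stopPath t' x = stopPath t' y) : stopPath t x = stopPath t y := by
  rw [stop_eq_iff hT hh ht]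
  rw [stop_eq_iff hT hh ht'] at H
  exact fun τ hτ => H τ (hτ.trans htt)

lemma norm_stop_mono (hT : 0 < T) (hh : 0 ≤ h) {t t' : ℝ} (ht : t ∈ Set.Icc 0 T)
    (ht' : t' ∈ Set.Icc 0 T) (htt : t ≤ t') (x : PathSp n h T) :
    ‖stopPath t x‖ ≤ ‖stopPath t' x‖ := by
  rw [norm_stop_le_iff hT hh ht (norm_nonneg _)]
  exact fun τ hτ => norm_evalP_le_stopd hT hh ht' x (hτ.trans htt)

lemma norm_stop_le (hT : 0 < T) (hh : 0 ≤ h) {t : ℝ} (ht : t ∈ Set.Icc 0 T)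
    (x : PathSp n h T) : ‖stopPath t x‖ ≤ ‖x‖ := by
  rw [norm_stop_le_iff hT hh ht (norm_nonneg _)]
  exact fun τ hτ => norm_evalP_le hT hh x τ

lemma stop_T (hT : 0 < T) (hh : 0 ≤ h) (x : PathSp n h T) : stopPath T x = x := by
  ext1 τ
  unfold stopPath
  simp only [ContinuousMap.comp_apply, ContinuousMap.coe_mk]
  congr 1
  apply Subtype.ext
  simp only [stopTime]
  rw [min_eq_left τ.2.2, max_eq_right τ.2.1]

lemma stop_stopd (hT : 0 < T) (hh : 0 ≤ h) {t : ℝ} (ht : t ∈ Set.Icc 0 T)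
    (x : PathSp n h T) : stopPath t (stopPath t x) = stopPath t x := by
  rw [stop_eq_iff hT hh ht]
  intro τ hτ
  rw [evalP_stopd hT hh ht, min_eq_left hτ]

lemma aemeas_stopd (hT : 0 < T) (hh : 0 ≤ h) (x : PathSp n h T) :
    AEMeasurable (fun t => ‖stopPath t x‖) (volume.restrict (Set.Icc 0 T)) := by
  apply aemeasurable_restrict_of_monotoneOn measurableSet_Icc
  intro a ha b hb hab
  exact norm_stop_mono hT hh ha hb hab x

/-- Continuity of `t ↦ x(·∧t)` (norm form, right modulus). -/
lemma norm_stop_le_add (hT : 0 < T) (hh : 0 ≤ h) {t t' : ℝ} (ht : t ∈ Set.Icc 0 T)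
    (ht' : t' ∈ Set.Icc 0 T) (x : PathSp n h T) {d : ℝ} (hd0 : 0 ≤ d)
    (hd : ∀ ξ ∈ Set.Icc t t', ‖evalP x ξ - evalP x t‖ ≤ d) :
    ‖stopPath t' x‖ ≤ ‖stopPath t x‖ + d := by
  rw [norm_stop_le_iff hT hh ht' (by positivity)]
  intro τ hτ
  rcases le_total τ t with h1 | h1
  · have := norm_evalP_le_stopd hT hh ht x h1
    linarith
  · have h2 := hd τ ⟨h1, hτ⟩
    have h3 := norm_evalP_le_stopd hT hh ht x le_rfl
    have h4 : ‖evalP x τ‖ ≤ ‖evalP x τ - evalP x t‖ + ‖evalP x t‖ := by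
      simpa using norm_add_le (evalP x τ - evalP x t) (evalP x t)
    linarith

/-- Full outer measure plus measurability gives an a.e. inequality. -/
lemma ae_le_of_full {T : ℝ} {f g : ℝ → ℝ}
    (hf : AEMeasurable f (volume.restrict (Set.Icc 0 T)))
    (hg : AEMeasurable g (volume.restrict (Set.Icc 0 T)))
    {E : Set ℝ} (hE : E ⊆ Set.Icc 0 T) (hv : volume E = ENNReal.ofReal T)
    (H : ∀ t ∈ E, f t ≤ g t) :
    ∀ᵐ t ∂(volume.restrict (Set.Icc 0 T)), f t ≤ g t := by
  have hm : NullMeasurableSet {t | f t ≤ g t} (volume.restrict (Set.Icc 0 T)) :=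
    nullMeasurableSet_le hf hg
  have hfin : IsFiniteMeasure (volume.restrict (Set.Icc (0:ℝ) T)) := by infer_instance
  rw [ae_iff]
  have hc : {a | ¬ f a ≤ g a} = {t | f t ≤ g t}ᶜ := rfl
  rw [hc, measure_compl₀ hm (measure_ne_top _ _)]
  have h1 : volume.restrict (Set.Icc 0 T) Set.univ = ENNReal.ofReal T := by
    simp
  have h2 : volume E ≤ volume.restrict (Set.Icc 0 T) {t | f t ≤ g t} := by
    calc volume E = volume.restrict (Set.Icc 0 T) E := by
          rw [Measure.restrict_apply' measurableSet_Icc, Set.inter_eq_left.2 hE]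
      _ ≤ _ := measure_mono (fun t ht => H t ht)
  rw [h1, ← hv]
  exact tsub_eq_zero_of_le h2

end basics


section hams
variable {n : ℕ} {h T : ℝ}

lemma ii_of {E : Type*} [NormedAddCommGroup E] {T : ℝ} {f : ℝ → E}
    (hf : IntegrableOn f (Set.Icc 0 T)) {a b : ℝ}
    (ha : a ∈ Set.Icc 0 T) (hb : b ∈ Set.Icc 0 T) : IntervalIntegrable f volume a b := by
  rw [intervalIntegrable_iff]
  apply hf.mono_set
  intro z hz
  have := Set.uIoc_subset_uIcc hz
  exact Set.uIcc_subset_Icc ha hb this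

lemma ae_sub {T : ℝ} {P : ℝ → Prop} (hP : ∀ᵐ ξ ∂(volume.restrict (Set.Icc 0 T)), P ξ) {a b : ℝ}
    (ha : a ∈ Set.Icc 0 T) (hb : b ∈ Set.Icc 0 T) :
    ∀ᵐ ξ ∂(volume.restrict (Set.Icc a b)), P ξ := by
  apply ae_mono (Measure.restrict_mono ?_ le_rfl) hP
  exact Set.Icc_subset_Icc ha.1 hb.2

lemma H_aemeas {H : ℝ → PathSp n h T → Euc n → ℝ} (hH : CondA1 H)
    (x : PathSp n h T) (s : Euc n) :
    AEMeasurable (fun t => H t x s) (volume.restrict (Set.Icc 0 T)) :=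
  aemeasurable_restrict_of_measurable_subtype measurableSet_Icc (hH x s)

lemma A3_ae (hT : 0 < T) (hh : 0 ≤ h) {H : ℝ → PathSp n h T → Euc n → ℝ} (h1 : CondA1 H)
    {D : Set (PathSp n h T)} {lam : ℝ → ℝ} (h3 : CondA3For H D lam)
    {x₁ x₂ : PathSp n h T} (hx₁ : x₁ ∈ D) (hx₂ : x₂ ∈ D) (s : Euc n) :
    ∀ᵐ t ∂(volume.restrict (Set.Icc 0 T)),
      |H t x₁ s - H t x₂ s| ≤ lam t * (1 + ‖s‖) * ‖stopPath t (x₁ - x₂)‖ := by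
  obtain ⟨E, hE, hv, hle⟩ := h3.2 x₁ hx₁ x₂ hx₂ s
  refine ae_le_of_full ?_ ?_ hE hv ?_
  · exact ((H_aemeas h1 x₁ s).sub (H_aemeas h1 x₂ s)).abs
  · exact ((h3.1.1.aestronglyMeasurable.aemeasurable).mul_const _).mul (aemeas_stopd hT hh _)
  · intro t ht
    rw [stop_sub]; exact hle t ht

lemma A4_ae (hT : 0 < T) (hh : 0 ≤ h) {H : ℝ → PathSp n h T → Euc n → ℝ} {cH : ℝ → ℝ}
    (h1 : CondA1 H) (h4 : CondA4 H cH) (x : PathSp n h T) (s₁ s₂ : Euc n) :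
    ∀ᵐ t ∂(volume.restrict (Set.Icc 0 T)),
      |H t x s₁ - H t x s₂| ≤ cH t * (1 + ‖stopPath t x‖) * ‖s₁ - s₂‖ := by
  obtain ⟨E, hE, hv, hle⟩ := h4.2
  refine ae_le_of_full ?_ ?_ hE hv ?_
  · exact ((H_aemeas h1 x s₁).sub (H_aemeas h1 x s₂)).abs
  · exact ((h4.1.1.aestronglyMeasurable.aemeasurable).mul
      ((aemeas_stopd hT hh _).const_add _)).mul_const _
  · intro t ht
    exact hle t ht x s₁ s₂

lemma H_integrable (hT : 0 < T) (hh : 0 ≤ h) {H : ℝ → PathSp n h T → Euc n → ℝ} {cH : ℝ → ℝ}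
    (hH : CondA H cH) (x : PathSp n h T) (s : Euc n) :
    IntegrableOn (fun t => H t x s) (Set.Icc 0 T) := by
  obtain ⟨h1, -, -, h4, h5⟩ := hH
  obtain ⟨m, hm, hm'⟩ := h5 {x} isCompact_singleton
  obtain ⟨E, hE, hv, hle⟩ := hm' x rfl
  have h5ae : ∀ᵐ t ∂(volume.restrict (Set.Icc 0 T)), |H t x 0| ≤ m t :=
    ae_le_of_full (H_aemeas h1 x 0).abs hm.1.aestronglyMeasurable.aemeasurable hE hv hle
  have hdom : IntegrableOn (fun t => m t + cH t * ((1 + ‖x‖) * ‖s‖)) (Set.Icc 0 T) :=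
    hm.1.add (h4.1.1.mul_const _)
  refine Integrable.mono' hdom (H_aemeas h1 x s).aestronglyMeasurable ?_
  filter_upwards [h5ae, A4_ae hT hh h1 h4 x s 0, ae_restrict_mem measurableSet_Icc] with t a1 a2 a3
  have hc := h4.1.2 t a3
  have hn := norm_stop_le hT hh a3 x
  rw [sub_zero] at a2
  have : cH t * (1 + ‖stopPath t x‖) * ‖s‖ ≤ cH t * ((1 + ‖x‖) * ‖s‖) := by
    rw [mul_assoc]; gcongr
  rw [Real.norm_eq_abs]
  have h6 : |H t x s| ≤ |H t x s - H t x 0| + |H t x 0| := by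
    simpa using abs_add_le (H t x s - H t x 0) (H t x 0)
  linarith

lemma H_nonant (hT : 0 < T) (hh : 0 ≤ h) {H : ℝ → PathSp n h T → Euc n → ℝ} {cH : ℝ → ℝ}
    (hH : CondA H cH) {τ : ℝ} (hτ : τ ∈ Set.Icc 0 T) {y z : PathSp n h T}
    (hyz : stopPath τ y = stopPath τ z) (s : Euc n) :
    ∀ᵐ t ∂(volume.restrict (Set.Icc 0 T)), t ≤ τ → H t y s = H t z s := by
  obtain ⟨h1, -, h3, -, -⟩ := hH
  obtain ⟨lam, hl⟩ := h3 {y, z} (by simp)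
  filter_upwards [A3_ae hT hh h1 hl (x₁ := y) (x₂ := z) (by simp) (by simp) s,
    ae_restrict_mem measurableSet_Icc] with t a1 a3 htτ
  have := stop_eq_mono hT hh a3 hτ htτ hyz
  rw [stop_sub, this, sub_self, norm_zero, mul_zero] at a1
  have := abs_nonpos_iff.1 a1
  linarith

/-- Derivative-free version of `Y(t,x;c)`. -/
def WSet (t : ℝ) (x : PathSp n h T) (c : ℝ → ℝ) : Set (PathSp n h T) :=
  {y | stopPath t y = stopPath t x ∧ ∀ a b, t ≤ a → a ≤ b → b ≤ T →
    ‖evalP y b - evalP y a‖ ≤ (1 + ‖stopPath b y‖) * ∫ ξ in a..b, c ξ}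

lemma int_nonneg {c : ℝ → ℝ} (hc : IntegNonneg T c) {a b : ℝ} (ha : 0 ≤ a) (hab : a ≤ b)
    (hb : b ≤ T) : 0 ≤ ∫ ξ in a..b, c ξ :=
  intervalIntegral.integral_nonneg hab (fun u hu => hc.2 u ⟨ha.trans hu.1, hu.2.trans hb⟩)

lemma int_mono_set {c : ℝ → ℝ} (hc : IntegNonneg T c) {a b a' b' : ℝ} (ha : 0 ≤ a')
    (haa : a' ≤ a) (hab : a ≤ b) (hbb : b ≤ b') (hb : b' ≤ T) :
    ∫ ξ in a..b, c ξ ≤ ∫ ξ in a'..b', c ξ := by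
  have i1 : IntervalIntegrable c volume a' a :=
    ii_of hc.1 ⟨ha, by linarith⟩ ⟨by linarith, by linarith⟩
  have i2 : IntervalIntegrable c volume a b :=
    ii_of hc.1 ⟨by linarith, by linarith⟩ ⟨by linarith, by linarith⟩
  have i3 : IntervalIntegrable c volume b b' :=
    ii_of hc.1 ⟨by linarith, by linarith⟩ ⟨by linarith, by linarith⟩
  rw [← intervalIntegral.integral_add_adjacent_intervals (i1.trans i2) i3,
    ← intervalIntegral.integral_add_adjacent_intervals i1 i2]
  have := int_nonneg hc ha haa (by linarith)
  have := int_nonneg hc (by linarith : 0 ≤ b) hbb hb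
  linarith

lemma YPair_W (hT : 0 < T) (hh : 0 ≤ h) {t : ℝ} (ht : t ∈ Set.Icc 0 T) {x : PathSp n h T}
    {c : ℝ → ℝ} (hc : IntegNonneg T c) {p : PathSp n h T × (ℝ → Euc n)} (hp : p ∈ YPair t x c) :
    p.1 ∈ WSet t x c := by
  obtain ⟨⟨h1, h2, h3⟩, h4⟩ := hp
  refine ⟨h1, fun a b ha hab hb => ?_⟩
  have ia : IntervalIntegrable p.2 volume t a := by
    apply h2.mono_set; rw [uIcc_of_le ha, uIcc_of_le ht.2]; exact Icc_subset_Icc le_rfl (by linarith)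
  have ib : IntervalIntegrable p.2 volume a b := by
    apply h2.mono_set; rw [uIcc_of_le hab, uIcc_of_le ht.2]; exact Icc_subset_Icc ha hb
  rw [h3 b ⟨by linarith, hb⟩, h3 a ⟨ha, by linarith⟩,
    ← intervalIntegral.integral_add_adjacent_intervals ia ib]
  have e : evalP p.1 t + (∫ ξ in t..a, p.2 ξ) + 0 = evalP p.1 t + ∫ ξ in t..a, p.2 ξ := add_zero _
  have : evalP p.1 t + ((∫ ξ in t..a, p.2 ξ) + ∫ ξ in a..b, p.2 ξ)
      - (evalP p.1 t + ∫ ξ in t..a, p.2 ξ) = ∫ ξ in a..b, p.2 ξ := by abel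
  rw [this]
  have ht0 := ht.1
  have iC : IntervalIntegrable c volume a b :=
    ii_of hc.1 ⟨by linarith, by linarith⟩ ⟨by linarith, by linarith⟩
  rw [← intervalIntegral.integral_const_mul]
  refine intervalIntegral.norm_integral_le_of_norm_le hab ?_ (iC.const_mul _)
  rw [ae_restrict_iff' measurableSet_Icc] at h4
  filter_upwards [h4] with ξ hξ hm
  have hξ1 := hξ ⟨by linarith [hm.1], by linarith [hm.2]⟩
  have hn := norm_stop_mono hT hh (t := ξ) (t' := b) ⟨by linarith [hm.1], by linarith [hm.2]⟩
    ⟨by linarith, hb⟩ hm.2 p.1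
  have hcc := hc.2 ξ ⟨by linarith [hm.1], by linarith [hm.2]⟩
  calc ‖p.2 ξ‖ ≤ c ξ * (1 + ‖stopPath ξ p.1‖) := hξ1
    _ ≤ c ξ * (1 + ‖stopPath b p.1‖) := by gcongr
    _ = _ := mul_comm _ _

lemma W_refl (hT : 0 < T) (hh : 0 ≤ h) {t : ℝ} (ht : t ∈ Set.Icc 0 T) (x : PathSp n h T)
    {c : ℝ → ℝ} (hc : IntegNonneg T c) : stopPath t x ∈ WSet t x c := by
  refine ⟨stop_stopd hT hh ht x, fun a b ha hab hb => ?_⟩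
  rw [evalP_stopd hT hh ht, evalP_stopd hT hh ht, min_eq_right ha, min_eq_right (ha.trans hab)]
  have := int_nonneg hc (ht.1.trans ha) hab hb
  simp only [sub_self, norm_zero]
  positivity

lemma W_trans (hT : 0 < T) (hh : 0 ≤ h) {t t' : ℝ} (ht : t ∈ Set.Icc 0 T)
    (ht' : t' ∈ Set.Icc 0 T) (htt : t ≤ t') {x y z : PathSp n h T}
    {c : ℝ → ℝ} (hc : IntegNonneg T c) (hy : y ∈ WSet t x c) (hz : z ∈ WSet t' y c) :
    z ∈ WSet t x c := by
  have hzy := (stop_eq_iff hT hh ht').1 hz.1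
  refine ⟨(stop_eq_mono hT hh ht ht' htt hz.1).trans hy.1, fun a b ha hab hb => ?_⟩
  have ht0 := ht.1
  have key : ∀ a b, t ≤ a → a ≤ b → b ≤ t' →
      ‖evalP z b - evalP z a‖ ≤ (1 + ‖stopPath b z‖) * ∫ ξ in a..b, c ξ := by
    intro a b ha hab hb
    rw [hzy b hb, hzy a (hab.trans hb),
      stop_eq_mono hT hh (t := b) ⟨by linarith, hb.trans ht'.2⟩ ht' hb hz.1]
    exact hy.2 a b ha hab (hb.trans ht'.2)
  rcases le_total b t' with hb1 | hb1
  · exact key a b ha hab hb1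
  rcases le_total t' a with ha1 | ha1
  · exact hz.2 a b ha1 hab hb
  have k1 := key a t' ha ha1 le_rfl
  have k2 := hz.2 t' b le_rfl hb1 hb
  have hn := norm_stop_mono hT hh ht' ⟨by linarith, hb⟩ hb1 z
  have i1 : IntervalIntegrable c volume a t' := ii_of hc.1 ⟨by linarith, by linarith⟩ ht'
  have i2 : IntervalIntegrable c volume t' b := ii_of hc.1 ht' ⟨by linarith, by linarith⟩
  rw [← intervalIntegral.integral_add_adjacent_intervals i1 i2]
  have n1 := int_nonneg hc (ht.1.trans ha) ha1 ht'.2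
  have e : ‖evalP z b - evalP z a‖ ≤ ‖evalP z b - evalP z t'‖ + ‖evalP z t' - evalP z a‖ :=
    norm_sub_le_norm_sub_add_norm_sub _ _ _
  have := mul_le_mul_of_nonneg_right (add_le_add_right hn 1) n1
  rw [mul_add]
  linarith

end hams


section nu
variable {n : ℕ} {h T : ℝ}

/-- regularized sup norm of the stopped path -/
def Mf (ε t : ℝ) (w : PathSp n h T) : ℝ := Real.sqrt (ε ^ 2 + ‖stopPath t w‖ ^ 2)

/-- Lyapunov-Krasovskii functional -/
def nuf (ε t : ℝ) (w : PathSp n h T) : ℝ :=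
  Mf ε t w + (ε ^ 2 + ‖evalP w t‖ ^ 2) / Mf ε t w

lemma Mf_ge (ε t : ℝ) (hε : 0 < ε) (w : PathSp n h T) : ε ≤ Mf ε t w := by
  apply Real.le_sqrt_of_sq_le
  have := sq_nonneg ‖stopPath t w‖
  linarith

lemma Mf_ge_norm (ε t : ℝ) (w : PathSp n h T) : ‖stopPath t w‖ ≤ Mf ε t w := by
  apply Real.le_sqrt_of_sq_le
  have := sq_nonneg ε
  linarith

lemma sqrt_lip {ε S S' d : ℝ} (hd : 0 ≤ d) (hS : 0 ≤ S) (hS' : 0 ≤ S') (hh : S' ≤ S + d) :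
    Real.sqrt (ε ^ 2 + S' ^ 2) ≤ Real.sqrt (ε ^ 2 + S ^ 2) + d := by
  have h1 : S ≤ Real.sqrt (ε ^ 2 + S ^ 2) := Real.le_sqrt_of_sq_le (by nlinarith [sq_nonneg ε])
  have h2 := Real.sq_sqrt (by positivity : 0 ≤ ε ^ 2 + S ^ 2)
  rw [Real.sqrt_le_left (by positivity)]
  nlinarith

lemma nu_real {ε M0 M1 u1 d : ℝ} (hε : 0 < ε) (h0 : ε ≤ M0) (h01 : M0 ≤ M1)
    (hd : M1 - M0 ≤ d) (hu : M1 = M0 ∨ M1 ≤ u1 + 2 * d) :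
    (M1 - M0) + u1 ^ 2 / M1 - u1 ^ 2 / M0 ≤ 4 * d ^ 2 / ε := by
  have hM0 : 0 < M0 := by linarith
  have hM1 : 0 < M1 := by linarith
  have hd0 : 0 ≤ d := by linarith
  rcases hu with hu | hu
  · subst hu
    have : 0 ≤ 4 * d ^ 2 / ε := by positivity
    linarith
  have k : M0 * M1 - u1 ^ 2 ≤ 4 * d * M0 := by
    rcases le_total M1 (4 * d) with hc | hc
    · nlinarith [sq_nonneg u1]
    · nlinarith [mul_nonneg (sub_nonneg.2 h01) (sub_nonneg.2 hc)]
  have e : (M1 - M0) + u1 ^ 2 / M1 - u1 ^ 2 / M0 = (M1 - M0) * (M0 * M1 - u1 ^ 2) / (M0 * M1) := by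
    field_simp
    ring
  rw [e]
  calc (M1 - M0) * (M0 * M1 - u1 ^ 2) / (M0 * M1)
      ≤ (M1 - M0) * (4 * d * M0) / (M0 * M1) := by
        gcongr
    _ = (M1 - M0) * (4 * d) / M1 := by field_simp
    _ ≤ d * (4 * d) / M1 := by gcongr
    _ ≤ d * (4 * d) / ε := by gcongr; linarith
    _ = 4 * d ^ 2 / ε := by ring

lemma Mf_step (hT : 0 < T) (hh : 0 ≤ h) {t t' : ℝ} (ht : t ∈ Set.Icc 0 T)
    (ht' : t' ∈ Set.Icc 0 T) (w : PathSp n h T) (ε : ℝ) {d : ℝ} (hd0 : 0 ≤ d)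
    (hd : ∀ ξ ∈ Set.Icc t t', ‖evalP w ξ - evalP w t‖ ≤ d) : Mf ε t' w ≤ Mf ε t w + d :=
  sqrt_lip hd0 (norm_nonneg _) (norm_nonneg _) (norm_stop_le_add hT hh ht ht' w hd0 hd)

lemma nu_step (hT : 0 < T) (hh : 0 ≤ h) {t t' : ℝ} (ht : t ∈ Set.Icc 0 T)
    (ht' : t' ∈ Set.Icc 0 T) (htt : t ≤ t') (w : PathSp n h T) {ε : ℝ} (hε : 0 < ε)
    {d : ℝ} (hd0 : 0 ≤ d)
    (hd : ∀ ξ ∈ Set.Icc t t', ‖evalP w ξ - evalP w t‖ ≤ d) :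
    nuf ε t' w - nuf ε t w ≤
      @inner ℝ _ _ ((2 / Mf ε t w) • evalP w t) (evalP w t' - evalP w t) + 5 * d ^ 2 / ε := by
  set M0 := Mf ε t w with hM0
  set M1 := Mf ε t' w with hM1
  set r1 := ‖evalP w t'‖ with hr1
  set u1 := Real.sqrt (ε ^ 2 + r1 ^ 2) with hu1
  have hu1s : u1 ^ 2 = ε ^ 2 + r1 ^ 2 := Real.sq_sqrt (by positivity)
  have hMM : M0 ≤ M1 := by
    apply Real.sqrt_le_sqrt
    have := norm_stop_mono hT hh ht ht' htt w
    gcongr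
  have hε0 : ε ≤ M0 := Mf_ge ε t hε w
  have hpos : 0 < M0 := by linarith
  have hstep : M1 ≤ M0 + d := Mf_step hT hh ht ht' w ε hd0 hd
  have hor : M1 = M0 ∨ M1 ≤ u1 + 2 * d := by
    by_cases hc : ‖stopPath t' w‖ ≤ ‖stopPath t w‖
    · left
      have : ‖stopPath t' w‖ = ‖stopPath t w‖ := le_antisymm hc (norm_stop_mono hT hh ht ht' htt w)
      simp only [hM0, hM1, Mf, this]
    · right
      push Not at hc
      apply sqrt_lip (by positivity) (norm_nonneg _) (norm_nonneg _)
      have : ‖stopPath t' w‖ ≤ max ‖stopPath t w‖ (r1 + 2 * d) := by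
        rw [norm_stop_le_iff hT hh ht' (le_max_of_le_left (norm_nonneg _))]
        intro τ hτ
        rcases le_total τ t with h1 | h1
        · exact le_max_of_le_left (norm_evalP_le_stopd hT hh ht w h1)
        · apply le_max_of_le_right
          have a1 := hd τ ⟨h1, hτ⟩
          have a2 := hd t' ⟨htt, le_rfl⟩
          have a3 : ‖evalP w τ‖ ≤ ‖evalP w τ - evalP w t‖ + ‖evalP w t - evalP w t'‖
              + ‖evalP w t'‖ := by
            have e : evalP w τ = (evalP w τ - evalP w t) + (evalP w t - evalP w t')
              + evalP w t' := by abel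
            conv_lhs => rw [e]
            exact norm_add₃_le
          rw [norm_sub_rev (evalP w t)] at a3
          linarith
      rcases le_max_iff.1 this with h2 | h2
      · exact absurd h2 (not_le.2 hc)
      · exact h2
  have key := nu_real hε hε0 hMM (by linarith) hor
  have e1 : r1 ^ 2 = ‖evalP w t‖ ^ 2 + 2 * @inner ℝ _ _ (evalP w t) (evalP w t' - evalP w t)
      + ‖evalP w t' - evalP w t‖ ^ 2 := by
    rw [hr1, ← norm_add_sq_real]; congr 2; abel
  have e2 : @inner ℝ _ _ ((2 / M0) • evalP w t) (evalP w t' - evalP w t) =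
      2 * @inner ℝ _ _ (evalP w t) (evalP w t' - evalP w t) / M0 := by
    rw [real_inner_smul_left]; ring
  have e3 : ‖evalP w t' - evalP w t‖ ^ 2 / M0 ≤ d ^ 2 / ε := by
    have := hd t' ⟨htt, le_rfl⟩
    gcongr
  have e4 : nuf ε t' w - nuf ε t w = ((M1 - M0) + u1 ^ 2 / M1 - u1 ^ 2 / M0)
      + (r1 ^ 2 - ‖evalP w t‖ ^ 2) / M0 := by
    simp only [nuf, ← hM0, ← hM1, hu1s, ← hr1]
    ring
  rw [e4, e2, e1]
  have e5 : 5 * d ^ 2 / ε = 4 * d ^ 2 / ε + d ^ 2 / ε := by ring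
  rw [e5]
  have e6 : ∀ a b c : ℝ, (a + 2 * b + c - a) / M0 = 2 * b / M0 + c / M0 := by
    intro a b c; ring
  rw [e6]
  linarith

lemma nuf_ge_Mf (ε t : ℝ) (hε : 0 < ε) (w : PathSp n h T) : Mf ε t w ≤ nuf ε t w := by
  have hp : 0 < Mf ε t w := lt_of_lt_of_le hε (Mf_ge ε t hε w)
  unfold nuf
  have : 0 ≤ (ε ^ 2 + ‖evalP w t‖ ^ 2) / Mf ε t w := by positivity
  linarith

lemma nuf_congr (hT : 0 < T) (hh : 0 ≤ h) {t : ℝ} (ht : t ∈ Set.Icc 0 T) (ε : ℝ)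
    {w z : PathSp n h T} (hwz : stopPath t w = stopPath t z) : nuf ε t w = nuf ε t z := by
  have := (stop_eq_iff hT hh ht).1 hwz t le_rfl
  simp only [nuf, Mf, hwz, this]

lemma nuf_zero (hT : 0 < T) (hh : 0 ≤ h) {t : ℝ} (ht : t ∈ Set.Icc 0 T) {ε : ℝ} (hε : 0 < ε) :
    nuf ε t (0 : PathSp n h T) = 2 * ε := by
  have h1 : stopPath t (0 : PathSp n h T) = 0 := by ext1; rfl
  have h2 : evalP (0 : PathSp n h T) t = 0 := by rw [evalP_eq hT hh]; rfl
  have h3 : Mf ε t (0 : PathSp n h T) = ε := by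
    simp [Mf, h1, Real.sqrt_sq hε.le]
  simp only [nuf, h2, h3, norm_zero]
  field_simp
  ring

end nu


section game
variable {n : ℕ} {h T : ℝ}

/-- error density coming from the difference of Hamiltonians -/
def errF (H1 H : ℝ → PathSp n h T → Euc n → ℝ) (c1 cH : ℝ → ℝ) (S : Finset (Euc n)) (q : ℝ)
    (y : PathSp n h T) (ξ : ℝ) : ℝ :=
  ∑ s ∈ S, |H1 ξ y s - H ξ y s| + (c1 ξ + cH ξ) * q

lemma errF_integrable (hT : 0 < T) (hh : 0 ≤ h) {H1 H : ℝ → PathSp n h T → Euc n → ℝ}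
    {c1 cH : ℝ → ℝ} (hH1 : CondA H1 c1) (hH : CondA H cH) (S : Finset (Euc n)) (q : ℝ)
    (y : PathSp n h T) : IntegrableOn (errF H1 H c1 cH S q y) (Set.Icc 0 T) := by
  apply Integrable.add
  · apply integrable_finsetSum
    intro s _
    exact ((H_integrable hT hh hH1 y s).sub (H_integrable hT hh hH y s)).abs
  · exact (hH1.2.2.2.1.1.1.add hH.2.2.2.1.1.1).mul_const _

lemma errF_integral (hT : 0 < T) (hh : 0 ≤ h) {H1 H : ℝ → PathSp n h T → Euc n → ℝ}
    {c1 cH : ℝ → ℝ} (hH1 : CondA H1 c1) (hH : CondA H cH) (S : Finset (Euc n)) (q : ℝ)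
    (y : PathSp n h T) : ∫ ξ in Set.Icc 0 T, errF H1 H c1 cH S q y ξ =
      ∑ s ∈ S, (∫ ξ in Set.Icc 0 T, |H1 ξ y s - H ξ y s|) +
        ((∫ ξ in Set.Icc 0 T, c1 ξ) + ∫ ξ in Set.Icc 0 T, cH ξ) * q := by
  have i1 : ∀ s ∈ S, Integrable (fun ξ => |H1 ξ y s - H ξ y s|) (volume.restrict (Set.Icc 0 T)) :=
    fun s _ => ((H_integrable hT hh hH1 y s).sub (H_integrable hT hh hH y s)).abs
  have i2 : Integrable (fun ξ => (c1 ξ + cH ξ) * q) (volume.restrict (Set.Icc 0 T)) :=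
    (hH1.2.2.2.1.1.1.add hH.2.2.2.1.1.1).mul_const _
  unfold errF
  rw [integral_add (integrable_finsetSum _ i1) i2, integral_finsetSum _ i1,
    integral_mul_const, integral_add hH1.2.2.2.1.1.1 hH.2.2.2.1.1.1]

lemma errF_nonneg {H1 H : ℝ → PathSp n h T → Euc n → ℝ}
    {c1 cH : ℝ → ℝ} (hc1 : IntegNonneg T c1) (hcH : IntegNonneg T cH) (S : Finset (Euc n)) {q : ℝ}
    (hq : 0 ≤ q) (y : PathSp n h T) {ξ : ℝ} (hξ : ξ ∈ Set.Icc 0 T) :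
    0 ≤ errF H1 H c1 cH S q y ξ := by
  have h1 := hc1.2 ξ hξ
  have h2 := hcH.2 ξ hξ
  unfold errF
  have : 0 ≤ ∑ s ∈ S, |H1 ξ y s - H ξ y s| := Finset.sum_nonneg (fun _ _ => abs_nonneg _)
  positivity

lemma errF_congr (hT : 0 < T) (hh : 0 ≤ h) {H1 H : ℝ → PathSp n h T → Euc n → ℝ}
    {c1 cH : ℝ → ℝ} (hH1 : CondA H1 c1) (hH : CondA H cH) (S : Finset (Euc n)) (q : ℝ)
    {y z : PathSp n h T} {t0 τ : ℝ} (ht0 : t0 ∈ Set.Icc 0 T) (hτ : τ ∈ Set.Icc 0 T) (h0 : t0 ≤ τ)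
    (hyz : stopPath τ y = stopPath τ z) :
    ∫ ξ in t0..τ, errF H1 H c1 cH S q y ξ = ∫ ξ in t0..τ, errF H1 H c1 cH S q z ξ := by
  have a1 : ∀ᵐ t ∂(volume.restrict (Set.Icc 0 T)), ∀ s ∈ S, t ≤ τ → H1 t y s = H1 t z s := by
    rw [Filter.eventually_all_finset]
    exact fun s _ => H_nonant hT hh hH1 hτ hyz s
  have a2 : ∀ᵐ t ∂(volume.restrict (Set.Icc 0 T)), ∀ s ∈ S, t ≤ τ → H t y s = H t z s := by
    rw [Filter.eventually_all_finset]
    exact fun s _ => H_nonant hT hh hH hτ hyz s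
  apply intervalIntegral.integral_congr_ae
  rw [ae_restrict_iff' measurableSet_Icc] at a1 a2
  filter_upwards [a1, a2] with ξ b1 b2 hξ
  rw [uIoc_of_le h0] at hξ
  have hm : ξ ∈ Set.Icc 0 T := ⟨by linarith [ht0.1, hξ.1], by linarith [hτ.2, hξ.2]⟩
  unfold errF
  congr 1
  apply Finset.sum_congr rfl
  intro s hs
  rw [b1 hm s hs hξ.2, b2 hm s hs hξ.2]

lemma errF_bound (hT : 0 < T) (hh : 0 ≤ h) {H1 H : ℝ → PathSp n h T → Euc n → ℝ}
    {c1 cH : ℝ → ℝ} (hH1 : CondA H1 c1) (hH : CondA H cH) {S : Finset (Euc n)} {R η : ℝ}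
    {y : PathSp n h T} (hy : ‖y‖ ≤ R) {s : Euc n} (hs : ∃ s' ∈ S, ‖s - s'‖ ≤ η) :
    ∀ᵐ ξ ∂(volume.restrict (Set.Icc 0 T)),
      |H1 ξ y s - H ξ y s| ≤ errF H1 H c1 cH S ((1 + R) * η) y ξ := by
  obtain ⟨s', hs', hn⟩ := hs
  filter_upwards [A4_ae hT hh hH1.1 hH1.2.2.2.1 y s s', A4_ae hT hh hH.1 hH.2.2.2.1 y s s',
    ae_restrict_mem measurableSet_Icc] with ξ a1 a2 hξ
  have hc1 := hH1.2.2.2.1.1.2 ξ hξ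
  have hcH := hH.2.2.2.1.1.2 ξ hξ
  have hst := norm_stop_le hT hh hξ y
  have b1 : c1 ξ * (1 + ‖stopPath ξ y‖) * ‖s - s'‖ ≤ c1 ξ * ((1 + R) * η) := by
    rw [mul_assoc]; gcongr
    · have := norm_nonneg y; linarith
    · linarith
  have b2 : cH ξ * (1 + ‖stopPath ξ y‖) * ‖s - s'‖ ≤ cH ξ * ((1 + R) * η) := by
    rw [mul_assoc]; gcongr
    · have := norm_nonneg y; linarith
    · linarith
  have b3 : |H1 ξ y s' - H ξ y s'| ≤ ∑ s ∈ S, |H1 ξ y s - H ξ y s| :=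
    Finset.single_le_sum (f := fun s => |H1 ξ y s - H ξ y s|) (fun _ _ => abs_nonneg _) hs'
  unfold errF
  have e : H1 ξ y s - H ξ y s = (H1 ξ y s - H1 ξ y s') + (H1 ξ y s' - H ξ y s')
    - (H ξ y s - H ξ y s') := by ring
  have b4 : |H1 ξ y s - H ξ y s| ≤ |H1 ξ y s - H1 ξ y s'| + |H1 ξ y s' - H ξ y s'|
      + |H ξ y s - H ξ y s'| := by
    rw [e]
    exact (abs_sub _ _).trans (add_le_add (abs_add_le _ _) le_rfl)
  linarith

/-- data for the extremal shift construction -/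
structure GD (H H1 H2 : ℝ → PathSp n h T → Euc n → ℝ) (cH c1 c2 : ℝ → ℝ)
    (φ1 φ2 : ℝ → PathSp n h T → ℝ) (t0 : ℝ) (x0 : PathSp n h T) (D : Set (PathSp n h T))
    (R : ℝ) (lam : ℝ → ℝ) (S : Finset (Euc n)) (η K : ℝ) (a : ℝ → ℝ) (ε : ℝ) : Prop where
  hH : CondA H cH
  hH1 : CondA H1 c1
  hH2 : CondA H2 c2
  U : PropU H1 c1 φ1
  L : PropL H2 c2 φ2
  na1 : NonAnticipative φ1
  na2 : NonAnticipative φ2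
  ht0 : t0 ∈ Set.Icc 0 T
  D1 : WSet t0 x0 c1 ⊆ D
  D2 : WSet t0 x0 c2 ⊆ D
  hR : ∀ y ∈ D, ‖y‖ ≤ R
  hR0 : 0 ≤ R
  hlam : CondA3For H D lam
  hS : ∀ s : Euc n, ‖s‖ ≤ 2 * K → ∃ s' ∈ S, ‖s - s'‖ ≤ η
  hη : 0 ≤ η
  hK : 0 < K
  ha0 : ∀ t ∈ Set.Icc 0 T, 0 < a t
  ha1 : ∀ t ∈ Set.Icc 0 T, a t ≤ 1
  hKa : ∀ t ∈ Set.Icc 0 T, 1 ≤ K * a t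
  hat : ∀ t ∈ Set.Icc 0 T, ∀ t' ∈ Set.Icc 0 T, t ≤ t' →
    a t' * (1 + 3 * ∫ ξ in t..t', lam ξ) ≤ a t
  hε : 0 < ε

/-- the inductive invariant -/
def GInv (H H1 H2 : ℝ → PathSp n h T → Euc n → ℝ) (cH c1 c2 : ℝ → ℝ)
    (φ1 φ2 : ℝ → PathSp n h T → ℝ) (t0 : ℝ) (x0 : PathSp n h T)
    (R : ℝ) (lam : ℝ → ℝ) (S : Finset (Euc n)) (η K : ℝ) (a : ℝ → ℝ) (ε : ℝ)
    (B κ t : ℝ) : Prop :=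
  ∃ y1 ∈ WSet t0 x0 c1, ∃ y2 ∈ WSet t0 x0 c2,
    K * a t * nuf ε t (y1 - y2) + φ1 t y1 - φ2 t y2 ≤ B +
      ((∫ ξ in t0..t, errF H1 H c1 cH S ((1 + R) * η) y1 ξ) +
       (∫ ξ in t0..t, errF H2 H c2 cH S ((1 + R) * η) y2 ξ) +
       κ * ∫ ξ in t0..t, (5 * K / ε * ((1 + R) * (c1 ξ + c2 ξ)) + 3 * K * lam ξ))

lemma final_arith {K a a' ν ν' ip d ε φ φ' E M Λ κ X G : ℝ} (hK : 0 < K) (hε : 0 < ε)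
    (ha' : 0 < a') (ha1 : a' ≤ 1) (hΛ : 0 ≤ Λ) (hd : 0 ≤ d) (hdκ : d ≤ κ) (hM : M ≤ ν)
    (hν : 0 ≤ ν)
    (hat : a' * (1 + 3 * Λ) ≤ a)
    (h1 : ν' - ν ≤ ip + 5 * d ^ 2 / ε)
    (h2 : φ' ≤ φ - K * a' * ip + X)
    (h3 : X ≤ E + 3 * (K * a') * (M + d) * Λ)
    (hG : G = 5 * K / ε * d + 3 * K * Λ) :
    K * a' * ν' + φ' ≤ K * a * ν + φ + E + κ * G := by
  have hKa : 0 < K * a' := by positivity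
  have e1 : K * a' * (ν' - ν) ≤ K * a' * (ip + 5 * d ^ 2 / ε) :=
    mul_le_mul_of_nonneg_left h1 hKa.le
  have e2 : K * (a' * (1 + 3 * Λ)) * ν ≤ K * a * ν := by gcongr
  have e3 : 3 * (K * a') * (M + d) * Λ ≤ 3 * (K * a') * (ν + d) * Λ := by gcongr
  have e4 : K * a' * (5 * d ^ 2 / ε) ≤ κ * (5 * K / ε * d) := by
    calc K * a' * (5 * d ^ 2 / ε) ≤ K * 1 * (5 * d ^ 2 / ε) := by gcongr
      _ = d * (5 * K / ε * d) := by ring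
      _ ≤ _ := by gcongr
  have e5 : 3 * (K * a') * d * Λ ≤ κ * (3 * K * Λ) := by
    calc 3 * (K * a') * d * Λ ≤ 3 * (K * 1) * d * Λ := by gcongr
      _ = d * (3 * K * Λ) := by ring
      _ ≤ _ := by gcongr
  rw [hG]
  nlinarith

end game


section step
variable {n : ℕ} {h T : ℝ}

lemma ACPair_inner {t : ℝ} {x : PathSp n h T}
    {p : PathSp n h T × (ℝ → Euc n)} (hp : p ∈ ACPair t x) {τ : ℝ} (hτ : τ ∈ Set.Icc t T)
    (s : Euc n) :
    IntervalIntegrable (fun ξ => @inner ℝ _ _ s (p.2 ξ)) volume t τ ∧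
    ∫ ξ in t..τ, @inner ℝ _ _ s (p.2 ξ) = @inner ℝ _ _ s (evalP p.1 τ - evalP p.1 t) := by
  obtain ⟨-, h2, h3⟩ := hp
  have i : IntervalIntegrable p.2 volume t τ := by
    apply h2.mono_set
    rw [uIcc_of_le hτ.1, uIcc_of_le (hτ.1.trans hτ.2)]
    exact Icc_subset_Icc le_rfl hτ.2
  constructor
  · exact ⟨(innerSL ℝ s).integrable_comp i.1, (innerSL ℝ s).integrable_comp i.2⟩
  · rw [h3 τ hτ, add_sub_cancel_left]
    exact (innerSL ℝ s).intervalIntegral_comp_comm i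

lemma game_step (hT : 0 < T) (hh : 0 ≤ h) {H H1 H2 : ℝ → PathSp n h T → Euc n → ℝ}
    {cH c1 c2 : ℝ → ℝ} {φ1 φ2 : ℝ → PathSp n h T → ℝ} {t0 : ℝ} {x0 : PathSp n h T}
    {D : Set (PathSp n h T)} {R : ℝ} {lam : ℝ → ℝ} {S : Finset (Euc n)} {η K : ℝ} {a : ℝ → ℝ}
    {ε : ℝ} (g : GD H H1 H2 cH c1 c2 φ1 φ2 t0 x0 D R lam S η K a ε) {B κ t t' : ℝ}
    (h0t : t0 ≤ t) (htt : t < t') (ht'T : t' ≤ T)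
    (hκ : ∫ ξ in t..t', (1 + R) * (c1 ξ + c2 ξ) ≤ κ)
    (hI : GInv H H1 H2 cH c1 c2 φ1 φ2 t0 x0 R lam S η K a ε B κ t) :
    GInv H H1 H2 cH c1 c2 φ1 φ2 t0 x0 R lam S η K a ε B κ t' := by
  obtain ⟨y1, hy1, y2, hy2, hI⟩ := hI
  have ht0 := g.ht0
  have ht : t ∈ Set.Icc 0 T := ⟨by linarith [ht0.1], by linarith⟩
  have ht' : t' ∈ Set.Icc 0 T := ⟨by linarith [ht.1], ht'T⟩
  have htt' := htt.le
  have hc1 := g.hH1.2.2.2.1.1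
  have hc2 := g.hH2.2.2.2.1.1
  have hR0 := g.hR0
  have hε := g.hε
  have hK := g.hK
  have hKa := g.hKa t' ht'
  set w := y1 - y2 with hw
  set M := Mf ε t w with hM
  have hMε : ε ≤ M := Mf_ge ε t hε w
  have hMpos : 0 < M := by linarith
  set s : Euc n := -((K * a t') • ((2 / M) • evalP w t)) with hs
  have hsn : ‖s‖ ≤ 2 * (K * a t') := by
    rw [hs, norm_neg, norm_smul, norm_smul, Real.norm_of_nonneg (by linarith),
      Real.norm_of_nonneg (by positivity)]
    have h1 : ‖evalP w t‖ ≤ M :=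
      (norm_evalP_le_stopd hT hh ht w le_rfl).trans (Mf_ge_norm ε t w)
    have h2 : 2 / M * ‖evalP w t‖ ≤ 2 := by
      calc 2 / M * ‖evalP w t‖ ≤ 2 / M * M := by gcongr
        _ = 2 := by field_simp
    nlinarith
  have hsK : ‖s‖ ≤ 2 * K := by
    have := g.ha1 t' ht'
    nlinarith
  have hnet := g.hS s hsK
  obtain ⟨p1, hp1, hu⟩ := g.U t ⟨ht.1, by linarith⟩ y1 s t' ⟨htt, ht'T⟩
  obtain ⟨p2, hp2, hl⟩ := g.L t ⟨ht.1, by linarith⟩ y2 s t' ⟨htt, ht'T⟩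
  have hW1' := YPair_W hT hh ht hc1 hp1
  have hW2' := YPair_W hT hh ht hc2 hp2
  set z1 := p1.1 with hz1
  set z2 := p2.1 with hz2
  have hW1 : z1 ∈ WSet t0 x0 c1 := W_trans hT hh ht0 ht h0t hc1 hy1 hW1'
  have hW2 : z2 ∈ WSet t0 x0 c2 := W_trans hT hh ht0 ht h0t hc2 hy2 hW2'
  have hD1 := g.D1 hW1
  have hD2 := g.D2 hW2
  have hn1 := g.hR _ hD1
  have hn2 := g.hR _ hD2
  set z := z1 - z2 with hz
  have hstp : stopPath t z = stopPath t w := by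
    rw [hz, hw, stop_sub, stop_sub, hW1'.1, hW2'.1]
  have hzt : evalP z t = evalP w t := (stop_eq_iff hT hh ht).1 hstp t le_rfl
  have hνt : nuf ε t z = nuf ε t w := nuf_congr hT hh ht ε hstp
  have hMt : Mf ε t z = M := by simp only [hM, Mf, hstp]
  set d := ∫ ξ in t..t', (1 + R) * (c1 ξ + c2 ξ) with hd
  have ic1 : ∀ {u v : ℝ}, u ∈ Set.Icc 0 T → v ∈ Set.Icc 0 T → IntervalIntegrable c1 volume u v :=
    fun hu hv => ii_of hc1.1 hu hv
  have ic2 : ∀ {u v : ℝ}, u ∈ Set.Icc 0 T → v ∈ Set.Icc 0 T → IntervalIntegrable c2 volume u v :=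
    fun hu hv => ii_of hc2.1 hu hv
  have hdeq : d = (1 + R) * ((∫ ξ in t..t', c1 ξ) + ∫ ξ in t..t', c2 ξ) := by
    rw [hd, intervalIntegral.integral_const_mul,
      intervalIntegral.integral_add (ic1 ht ht') (ic2 ht ht')]
  have hd0 : 0 ≤ d := by
    have h1 := int_nonneg hc1 ht.1 htt' ht'T
    have h2 := int_nonneg hc2 ht.1 htt' ht'T
    rw [hdeq]; positivity
  have hosc : ∀ ξ ∈ Set.Icc t t', ‖evalP z ξ - evalP z t‖ ≤ d := by
    intro ξ hξ
    have hξT : ξ ∈ Set.Icc 0 T := ⟨ht.1.trans hξ.1, hξ.2.trans ht'T⟩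
    have b1 := hW1'.2 t ξ le_rfl hξ.1 hξT.2
    have b2 := hW2'.2 t ξ le_rfl hξ.1 hξT.2
    have m1 := int_mono_set hc1 ht.1 le_rfl hξ.1 hξ.2 ht'T
    have m2 := int_mono_set hc2 ht.1 le_rfl hξ.1 hξ.2 ht'T
    have k1 := int_nonneg hc1 ht.1 hξ.1 hξT.2
    have k2 := int_nonneg hc2 ht.1 hξ.1 hξT.2
    have s1 := (norm_stop_le hT hh hξT z1).trans hn1
    have s2 := (norm_stop_le hT hh hξT z2).trans hn2
    have e : evalP z ξ - evalP z t = (evalP z1 ξ - evalP z1 t) - (evalP z2 ξ - evalP z2 t) := by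
      rw [hz, evalP_sub hT hh, evalP_sub hT hh]; abel
    rw [e, hdeq, mul_add]
    refine (norm_sub_le _ _).trans (add_le_add (b1.trans ?_) (b2.trans ?_))
    · gcongr
    · gcongr
  have hnu := nu_step hT hh ht ht' htt' z hε hd0 hosc
  rw [hνt, hMt, hzt] at hnu
  -- the integrals
  have hint1 := ACPair_inner hp1.1 (τ := t') ⟨htt', ht'T⟩ s
  have hint2 := ACPair_inner hp2.1 (τ := t') ⟨htt', ht'T⟩ s
  have iH1 : IntervalIntegrable (fun ξ => H1 ξ z1 s) volume t t' :=
    ii_of (H_integrable hT hh g.hH1 z1 s) ht ht'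
  have iH2 : IntervalIntegrable (fun ξ => H2 ξ z2 s) volume t t' :=
    ii_of (H_integrable hT hh g.hH2 z2 s) ht ht'
  rw [intervalIntegral.integral_sub hint1.1 iH1, hint1.2] at hu
  rw [intervalIntegral.integral_sub hint2.1 iH2, hint2.2] at hl
  have iE1 := errF_integrable hT hh g.hH1 g.hH S ((1 + R) * η) z1
  have iE2 := errF_integrable hT hh g.hH2 g.hH S ((1 + R) * η) z2
  set E1 := errF H1 H c1 cH S ((1 + R) * η) z1 with hE1
  set E2 := errF H2 H c2 cH S ((1 + R) * η) z2 with hE2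
  have hlam := g.hlam
  have ilam : IntervalIntegrable lam volume t t' := ii_of hlam.1.1 ht ht'
  set Λ := ∫ ξ in t..t', lam ξ with hΛ
  have hΛ0 : 0 ≤ Λ := int_nonneg hlam.1 ht.1 htt' ht'T
  have hX : (∫ ξ in t..t', H2 ξ z2 s) - (∫ ξ in t..t', H1 ξ z1 s) ≤
      ((∫ ξ in t..t', E1 ξ) + ∫ ξ in t..t', E2 ξ) + 3 * (K * a t') * (M + d) * Λ := by
    rw [← intervalIntegral.integral_sub iH2 iH1]
    have i12 : IntervalIntegrable (fun ξ => E1 ξ + E2 ξ) volume t t' :=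
      (ii_of iE1 ht ht').add (ii_of iE2 ht ht')
    have il : IntervalIntegrable (fun ξ => 3 * (K * a t') * (M + d) * lam ξ) volume t t' :=
      ilam.const_mul _
    have e : ((∫ ξ in t..t', E1 ξ) + ∫ ξ in t..t', E2 ξ) + 3 * (K * a t') * (M + d) * Λ =
        ∫ ξ in t..t', (E1 ξ + E2 ξ + 3 * (K * a t') * (M + d) * lam ξ) := by
      rw [intervalIntegral.integral_add i12 il, intervalIntegral.integral_const_mul,
        intervalIntegral.integral_add (ii_of iE1 ht ht') (ii_of iE2 ht ht')]
    rw [e]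
    refine intervalIntegral.integral_mono_ae_restrict htt' (iH2.sub iH1) (i12.add il) ?_
    filter_upwards [ae_sub (errF_bound hT hh g.hH1 g.hH hn1 hnet) ht ht',
      ae_sub (errF_bound hT hh g.hH2 g.hH hn2 hnet) ht ht',
      ae_sub (A3_ae hT hh g.hH.1 hlam hD1 hD2 s) ht ht',
      ae_restrict_mem measurableSet_Icc] with ξ b1 b2 b3 hξ
    have hξT : ξ ∈ Set.Icc 0 T := ⟨ht.1.trans hξ.1, hξ.2.trans ht'T⟩
    have hMξ : ‖stopPath ξ z‖ ≤ M + d := by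
      rw [← hMt]
      exact (Mf_ge_norm ε ξ z).trans (Mf_step hT hh ht hξT z ε hd0
        (fun ζ hζ => hosc ζ ⟨hζ.1, hζ.2.trans hξ.2⟩))
    have hl0 := hlam.1.2 ξ hξT
    have b4 : lam ξ * (1 + ‖s‖) * ‖stopPath ξ z‖ ≤ 3 * (K * a t') * (M + d) * lam ξ := by
      calc lam ξ * (1 + ‖s‖) * ‖stopPath ξ z‖ ≤ lam ξ * (3 * (K * a t')) * (M + d) := by
            gcongr
            linarith
        _ = _ := by ring
    have c1 := abs_le.1 b1
    have c2 := abs_le.1 b2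
    have c3 := abs_le.1 (b3.trans b4)
    show H2 ξ z2 s - H1 ξ z1 s ≤ E1 ξ + E2 ξ + 3 * (K * a t') * (M + d) * lam ξ
    have d1 := c1.1
    have d2 := c2.2
    have d3 := c3.1
    linarith
  -- collect
  have hφ1 : φ1 t z1 = φ1 t y1 := by rw [g.na1 t ht z1, g.na1 t ht y1, hW1'.1]
  have hφ2 : φ2 t z2 = φ2 t y2 := by rw [g.na2 t ht z2, g.na2 t ht y2, hW2'.1]
  set ip := @inner ℝ _ _ ((2 / M) • evalP w t) (evalP z t' - evalP w t) with hip
  have hinn : @inner ℝ _ _ s (evalP z1 t' - evalP z1 t) - @inner ℝ _ _ s (evalP z2 t' - evalP z2 t)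
      = - (K * a t' * ip) := by
    rw [← inner_sub_right, hip, ← hzt, hs, inner_neg_left, real_inner_smul_left]
    congr 3
    · rw [hzt]
    · rw [hz, evalP_sub hT hh, evalP_sub hT hh]; abel
  have iG : IntegrableOn (fun ξ => 5 * K / ε * ((1 + R) * (c1 ξ + c2 ξ)) + 3 * K * lam ξ)
      (Set.Icc 0 T) :=
    (((hc1.1.add hc2.1).const_mul _).const_mul _).add (hlam.1.1.const_mul _)
  have hG : ∫ ξ in t..t', (5 * K / ε * ((1 + R) * (c1 ξ + c2 ξ)) + 3 * K * lam ξ) =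
      5 * K / ε * d + 3 * K * Λ := by
    have iA : IntervalIntegrable (fun ξ => 5 * K / ε * ((1 + R) * (c1 ξ + c2 ξ))) volume t t' :=
      (((ic1 ht ht').add (ic2 ht ht')).const_mul _).const_mul _
    rw [intervalIntegral.integral_add iA (ilam.const_mul _), hd, hΛ]
    simp only [intervalIntegral.integral_const_mul]
  have hfin := final_arith (K := K) (a := a t) (a' := a t') (ν := nuf ε t w) (ν' := nuf ε t' z)
    (ip := ip) (d := d) (ε := ε) (φ := φ1 t y1 - φ2 t y2) (φ' := φ1 t' z1 - φ2 t' z2)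
    (E := (∫ ξ in t..t', E1 ξ) + ∫ ξ in t..t', E2 ξ) (M := M) (Λ := Λ) (κ := κ)
    (X := (∫ ξ in t..t', H2 ξ z2 s) - (∫ ξ in t..t', H1 ξ z1 s)) hK hε (g.ha0 t' ht') (g.ha1 t' ht')
    hΛ0 hd0 hκ (nuf_ge_Mf ε t hε w) (hMpos.le.trans (nuf_ge_Mf ε t hε w))
    (g.hat t ht t' ht' htt') hnu (by linarith) hX hG
  refine ⟨z1, hW1, z2, hW2, ?_⟩
  rw [← intervalIntegral.integral_add_adjacent_intervals (ii_of iE1 ht0 ht) (ii_of iE1 ht ht'),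
    ← intervalIntegral.integral_add_adjacent_intervals (ii_of iE2 ht0 ht) (ii_of iE2 ht ht'),
    ← intervalIntegral.integral_add_adjacent_intervals (ii_of iG ht0 ht) (ii_of iG ht ht'),
    hE1, hE2, errF_congr hT hh g.hH1 g.hH S _ ht0 ht h0t hW1'.1,
    errF_congr hT hh g.hH2 g.hH S _ ht0 ht h0t hW2'.1, ← hE1, ← hE2, mul_add]
  linarith

end step


section run
variable {n : ℕ} {h T : ℝ}

lemma equi_one (hT : 0 < T) {c : ℝ → ℝ} (hc : IntegrableOn c (Set.Icc 0 T)) {η : ℝ} (hη : 0 < η) :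
    ∃ δ > 0, ∀ a b, 0 ≤ a → a ≤ b → b ≤ T → b - a ≤ δ → ∫ ξ in a..b, c ξ ≤ η := by
  have hcont : ContinuousOn (fun t => ∫ ξ in (0:ℝ)..t, c ξ) (Set.Icc 0 T) := by
    have := intervalIntegral.continuousOn_primitive_interval (a := 0) (b := T) (f := c)
      (μ := volume) (by rwa [uIcc_of_le hT.le])
    rwa [uIcc_of_le hT.le] at this
  have hu := isCompact_Icc.uniformContinuousOn_of_continuous hcont
  rw [Metric.uniformContinuousOn_iff] at hu
  obtain ⟨δ, hδ, hu⟩ := hu η hη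
  refine ⟨δ / 2, by positivity, fun a b ha hab hb hd => ?_⟩
  have ha' : a ∈ Set.Icc 0 T := ⟨ha, hab.trans hb⟩
  have hb' : b ∈ Set.Icc 0 T := ⟨ha.trans hab, hb⟩
  have h1 := hu b hb' a ha' (by rw [Real.dist_eq, abs_of_nonneg (by linarith)]; linarith)
  have h0 : (0:ℝ) ∈ Set.Icc 0 T := ⟨le_rfl, hT.le⟩
  rw [Real.dist_eq, intervalIntegral.integral_interval_sub_left (ii_of hc h0 hb') (ii_of hc h0 ha')] at h1
  exact (le_abs_self _).trans h1.le

lemma int_le_set {c : ℝ → ℝ} (hT : 0 < T) (hc : IntegNonneg T c) {a b : ℝ} (ha : 0 ≤ a) (hab : a ≤ b)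
    (hb : b ≤ T) : ∫ ξ in a..b, c ξ ≤ ∫ ξ in Set.Icc 0 T, c ξ := by
  have := int_mono_set hc le_rfl ha hab hb le_rfl
  rwa [intervalIntegral.integral_of_le hT.le, ← integral_Icc_eq_integral_Ioc] at this

lemma game_run (hT : 0 < T) (hh : 0 ≤ h) {H H1 H2 : ℝ → PathSp n h T → Euc n → ℝ}
    {cH c1 c2 : ℝ → ℝ} {φ1 φ2 : ℝ → PathSp n h T → ℝ} {t0 : ℝ} {x0 : PathSp n h T}
    {D : Set (PathSp n h T)} {R : ℝ} {lam : ℝ → ℝ} {S : Finset (Euc n)} {η K : ℝ} {a : ℝ → ℝ}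
    {ε : ℝ} (g : GD H H1 H2 cH c1 c2 φ1 φ2 t0 x0 D R lam S η K a ε) {θ : ℝ} (hθ : 0 < θ) :
    ∃ y1 ∈ WSet t0 x0 c1, ∃ y2 ∈ WSet t0 x0 c2,
      K * a T * ‖y1 - y2‖ + φ1 T y1 - φ2 T y2 ≤ 2 * K * ε + φ1 t0 x0 - φ2 t0 x0 +
        (∫ ξ in Set.Icc 0 T, errF H1 H c1 cH S ((1 + R) * η) y1 ξ) +
        (∫ ξ in Set.Icc 0 T, errF H2 H c2 cH S ((1 + R) * η) y2 ξ) + θ := by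
  have hc1 := g.hH1.2.2.2.1.1
  have hc2 := g.hH2.2.2.2.1.1
  have hcH := g.hH.2.2.2.1.1
  have hR0 := g.hR0
  have hη := g.hη
  have hK := g.hK
  have hε := g.hε
  have ht0 := g.ht0
  have hTm : T ∈ Set.Icc 0 T := ⟨hT.le, le_rfl⟩
  have hG : IntegNonneg T (fun ξ => 5 * K / ε * ((1 + R) * (c1 ξ + c2 ξ)) + 3 * K * lam ξ) := by
    refine ⟨(((hc1.1.add hc2.1).const_mul _).const_mul _).add (g.hlam.1.1.const_mul _),
      fun τ hτ => ?_⟩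
    have h1 := hc1.2 τ hτ
    have h2 := hc2.2 τ hτ
    have h3 := g.hlam.1.2 τ hτ
    positivity
  set G := ∫ ξ in t0..T, (5 * K / ε * ((1 + R) * (c1 ξ + c2 ξ)) + 3 * K * lam ξ) with hGd
  have hG0 : 0 ≤ G := int_nonneg hG ht0.1 ht0.2 le_rfl
  set κ := θ / (G + 1) with hκ
  have hκ0 : 0 < κ := by positivity
  have hκG : κ * G ≤ θ := by
    rw [hκ, div_mul_eq_mul_div, div_le_iff₀ (by positivity)]
    nlinarith
  obtain ⟨δ, hδ, hδ'⟩ := equi_one hT (c := fun ξ => (1 + R) * (c1 ξ + c2 ξ))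
    ((hc1.1.add hc2.1).const_mul _) hκ0
  set B := 2 * K * ε + φ1 t0 x0 - φ2 t0 x0 with hB
  have hstart : GInv H H1 H2 cH c1 c2 φ1 φ2 t0 x0 R lam S η K a ε B κ t0 := by
    refine ⟨_, W_refl hT hh ht0 x0 hc1, _, W_refl hT hh ht0 x0 hc2, ?_⟩
    rw [sub_self, nuf_zero hT hh ht0 hε, ← g.na1 t0 ht0, ← g.na2 t0 ht0]
    simp only [intervalIntegral.integral_same]
    have h1 := g.ha1 t0 ht0
    have h2 : K * a t0 * (2 * ε) ≤ K * 1 * (2 * ε) := by gcongr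
    rw [hB]; linarith
  have hind : ∀ j : ℕ, ∀ t, t0 ≤ t → t ≤ T → t ≤ t0 + j * δ →
      GInv H H1 H2 cH c1 c2 φ1 φ2 t0 x0 R lam S η K a ε B κ t := by
    intro j
    induction j with
    | zero =>
      intro t h1 _ h2
      have : t = t0 := by simp at h2; linarith
      rw [this]; exact hstart
    | succ j ih =>
      intro t h1 h2 h3
      by_cases hc : t ≤ t0 + j * δ
      · exact ih t h1 h2 hc
      · push Not at hc
        have hj : 0 ≤ j * δ := by positivity
        have := ih (t0 + j * δ) (by linarith) (by linarith) le_rfl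
        push_cast at h3
        exact game_step hT hh g (by linarith) hc h2
          (hδ' _ _ (by linarith [ht0.1]) hc.le h2 (by linarith)) this
  obtain ⟨N, hN⟩ := exists_nat_gt ((T - t0) / δ)
  rw [div_lt_iff₀ hδ] at hN
  obtain ⟨y1, hy1, y2, hy2, hI⟩ := hind N T ht0.2 le_rfl (by linarith)
  refine ⟨y1, hy1, y2, hy2, ?_⟩
  have hq : 0 ≤ (1 + R) * η := by positivity
  have e1 := int_le_set hT (c := errF H1 H c1 cH S ((1 + R) * η) y1)
    ⟨errF_integrable hT hh g.hH1 g.hH S _ y1, fun τ hτ => errF_nonneg hc1 hcH S hq y1 hτ⟩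
    ht0.1 ht0.2 le_rfl
  have e2 := int_le_set hT (c := errF H2 H c2 cH S ((1 + R) * η) y2)
    ⟨errF_integrable hT hh g.hH2 g.hH S _ y2, fun τ hτ => errF_nonneg hc2 hcH S hq y2 hτ⟩
    ht0.1 ht0.2 le_rfl
  have e3 : ‖y1 - y2‖ ≤ nuf ε T (y1 - y2) := by
    have := (Mf_ge_norm ε T (y1 - y2)).trans (nuf_ge_Mf ε T hε _)
    rwa [stop_T hT hh] at this
  have hKa := g.hKa T hTm
  have e4 : K * a T * ‖y1 - y2‖ ≤ K * a T * nuf ε T (y1 - y2) := by gcongr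
  linarith

end run


section cpt
variable {n : ℕ} {h T : ℝ}

/-- uniform equi-integrability of a family -/
def Equi (T : ℝ) (c : ℕ → ℝ → ℝ) : Prop :=
  ∀ η > 0, ∃ δ > 0, ∀ k a b, 0 ≤ a → a ≤ b → b ≤ T → b - a ≤ δ → ∫ ξ in a..b, c k ξ ≤ η

lemma int_le_L1 (hT : 0 < T) {c1 c : ℝ → ℝ} (hc1 : IntegNonneg T c1) (hc : IntegNonneg T c)
    {a b : ℝ} (ha : 0 ≤ a) (hab : a ≤ b) (hb : b ≤ T) :
    ∫ ξ in a..b, c1 ξ ≤ (∫ ξ in a..b, c ξ) + L1dist T c1 c := by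
  have ha' : a ∈ Set.Icc 0 T := ⟨ha, hab.trans hb⟩
  have hb' : b ∈ Set.Icc 0 T := ⟨ha.trans hab, hb⟩
  have hd : IntegNonneg T (fun ξ => |c1 ξ - c ξ|) :=
    ⟨(hc1.1.sub hc.1).abs, fun _ _ => abs_nonneg _⟩
  have h1 := int_le_set hT hd ha hab hb
  have h2 : ∫ ξ in a..b, (c1 ξ - c ξ) ≤ ∫ ξ in a..b, |c1 ξ - c ξ| :=
    intervalIntegral.integral_mono_on hab ((ii_of hc1.1 ha' hb').sub (ii_of hc.1 ha' hb'))
      (ii_of hd.1 ha' hb') (fun _ _ => le_abs_self _)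
  rw [intervalIntegral.integral_sub (ii_of hc1.1 ha' hb') (ii_of hc.1 ha' hb')] at h2
  unfold L1dist
  linarith

lemma equi_seq (hT : 0 < T) {cH : ℝ → ℝ} {cHk : ℕ → ℝ → ℝ} (hc : IntegNonneg T cH)
    (hck : ∀ k, IntegNonneg T (cHk k))
    (hconv : Tendsto (fun k => L1dist T (cHk k) cH) atTop (nhds 0)) : Equi T cHk := by
  intro η hη
  obtain ⟨N, hN⟩ := eventually_atTop.1 (hconv.eventually (ge_mem_nhds (half_pos hη)))
  obtain ⟨δ0, hδ0, h0⟩ := equi_one hT hc.1 (half_pos hη)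
  have hfin : ∀ N : ℕ, ∃ δ > 0, ∀ k < N, ∀ a b, 0 ≤ a → a ≤ b → b ≤ T → b - a ≤ δ →
      ∫ ξ in a..b, cHk k ξ ≤ η := by
    intro N
    induction N with
    | zero => exact ⟨1, one_pos, fun k hk => absurd hk (Nat.not_lt_zero k)⟩
    | succ N ih =>
      obtain ⟨δ1, hδ1, h1⟩ := ih
      obtain ⟨δ2, hδ2, h2⟩ := equi_one hT (hck N).1 hη
      refine ⟨min δ1 δ2, lt_min hδ1 hδ2, fun k hk a b ha hab hb hd => ?_⟩
      rcases Nat.lt_succ_iff_lt_or_eq.1 hk with h | h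
      · exact h1 k h a b ha hab hb (hd.trans (min_le_left _ _))
      · rw [h]; exact h2 a b ha hab hb (hd.trans (min_le_right _ _))
  obtain ⟨δ1, hδ1, h1⟩ := hfin N
  refine ⟨min δ0 δ1, lt_min hδ0 hδ1, fun k a b ha hab hb hd => ?_⟩
  by_cases hk : k < N
  · exact h1 k hk a b ha hab hb (hd.trans (min_le_right _ _))
  · have e1 := int_le_L1 hT (hck k) hc ha hab hb
    have e2 := hN k (not_lt.1 hk)
    have e3 := h0 a b ha hab hb (hd.trans (min_le_left _ _))
    linarith

lemma tot_bdd (hT : 0 < T) {cH : ℝ → ℝ} {cHk : ℕ → ℝ → ℝ} (hc : IntegNonneg T cH)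
    (hck : ∀ k, IntegNonneg T (cHk k))
    (hconv : Tendsto (fun k => L1dist T (cHk k) cH) atTop (nhds 0)) :
    ∃ A ≥ 0, (∀ k, ∫ ξ in Set.Icc 0 T, cHk k ξ ≤ A) ∧ ∫ ξ in Set.Icc 0 T, cH ξ ≤ A := by
  obtain ⟨B, hB⟩ := hconv.bddAbove_range
  have h1 : ∀ k, L1dist T (cHk k) cH ≤ B := fun k => hB ⟨k, rfl⟩
  have hB0 : 0 ≤ B := (integral_nonneg (fun _ => abs_nonneg _)).trans (h1 0)
  have e : ∀ c : ℝ → ℝ, ∫ ξ in Set.Icc 0 T, c ξ = ∫ ξ in (0:ℝ)..T, c ξ := fun c => by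
    rw [intervalIntegral.integral_of_le hT.le, ← integral_Icc_eq_integral_Ioc]
  have h2 := int_nonneg hc le_rfl hT.le le_rfl
  refine ⟨(∫ ξ in (0:ℝ)..T, cH ξ) + B, by linarith, fun k => ?_, ?_⟩
  · rw [e]
    have := int_le_L1 hT (hck k) hc le_rfl hT.le le_rfl
    linarith [h1 k]
  · rw [e]; linarith

lemma W_bdd (hT : 0 < T) (hh : 0 ≤ h) {c : ℕ → ℝ → ℝ} (hck : ∀ k, IntegNonneg T (c k))
    (he : Equi T c) : ∃ A ≥ 1, ∀ k, ∀ t0 ∈ Set.Icc 0 T, ∀ x0 : PathSp n h T,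
      ∀ y ∈ WSet t0 x0 (c k), 1 + ‖y‖ ≤ A * (1 + ‖x0‖) := by
  obtain ⟨δ, hδ, he⟩ := he (1 / 2) (by norm_num)
  obtain ⟨N, hN⟩ := exists_nat_gt (T / δ)
  rw [div_lt_iff₀ hδ] at hN
  refine ⟨2 ^ N, one_le_pow₀ (by norm_num), fun k t0 ht0 x0 y hy => ?_⟩
  have hind : ∀ j : ℕ, ∀ b, t0 ≤ b → b ≤ T → b ≤ t0 + j * δ →
      1 + ‖stopPath b y‖ ≤ 2 ^ j * (1 + ‖x0‖) := by
    intro j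
    induction j with
    | zero =>
      intro b h1 h2 h3
      have : b = t0 := by simp at h3; linarith
      rw [this, hy.1]
      have := norm_stop_le hT hh ht0 x0
      simpa using this
    | succ j ih =>
      intro b h1 h2 h3
      by_cases hcs : b ≤ t0 + j * δ
      · refine (ih b h1 h2 hcs).trans ?_
        gcongr
        · norm_num
        · omega
      · push Not at hcs
        have hj : 0 ≤ j * δ := by positivity
        have hi := ih (t0 + j * δ) (by linarith) (by linarith) le_rfl
        push_cast at h3
        have ha : t0 + j * δ ∈ Set.Icc 0 T := ⟨by linarith [ht0.1], by linarith⟩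
        have hb : b ∈ Set.Icc 0 T := ⟨by linarith [ht0.1], h2⟩
        have := norm_stop_le_add hT hh ha hb y (d := (1 + ‖stopPath b y‖) * (1 / 2))
          (by positivity) (by
            intro ξ hξ
            have hξT : ξ ∈ Set.Icc 0 T := ⟨ha.1.trans hξ.1, hξ.2.trans h2⟩
            refine (hy.2 _ ξ (by linarith) hξ.1 hξT.2).trans ?_
            have m1 := norm_stop_mono hT hh hξT hb hξ.2 y
            have m2 := he k _ ξ ha.1 hξ.1 hξT.2 (by linarith [hξ.2])
            have m3 := int_nonneg (hck k) ha.1 hξ.1 hξT.2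
            gcongr)
        rw [pow_succ]
        linarith
  have := hind N T ht0.2 le_rfl (by linarith [ht0.1])
  rwa [stop_T hT hh] at this

lemma W_compact (hT : 0 < T) (hh : 0 ≤ h) {c : ℕ → ℝ → ℝ} (hck : ∀ k, IntegNonneg T (c k))
    (he : Equi T c) {D : Set (PathSp n h T)} (hD : IsCompact D) :
    ∃ K : Set (PathSp n h T), IsCompact K ∧ ∀ k, ∀ t0 ∈ Set.Icc 0 T, ∀ x0 ∈ D,
      WSet t0 x0 (c k) ⊆ K := by
  obtain ⟨A, hA1, hA⟩ := W_bdd (n := n) hT hh hck he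
  obtain ⟨r, hr⟩ := hD.isBounded.exists_norm_le
  set R := A * (1 + |r|) with hR
  have hR0 : 0 ≤ R := by positivity
  set Y : Set (PathSp n h T) := {y | ∃ k, ∃ t0 ∈ Set.Icc 0 T, ∃ x0 ∈ D, y ∈ WSet t0 x0 (c k)} with hY
  have hYR : ∀ y ∈ Y, ‖y‖ ≤ R := by
    rintro y ⟨k, t0, ht0, x0, hx0, hy⟩
    have h1 := hA k t0 ht0 x0 y hy
    have h2 : ‖x0‖ ≤ |r| := (hr x0 hx0).trans (le_abs_self r)
    have h3 : A * (1 + ‖x0‖) ≤ R := by rw [hR]; gcongr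
    linarith
  have hequi : ∀ ε > 0, ∃ δ > 0, ∀ y ∈ Y, ∀ τ τ' : ℝ, -h ≤ τ → τ ≤ τ' → τ' ≤ T → τ' - τ ≤ δ →
      ‖evalP y τ' - evalP y τ‖ ≤ ε := by
    intro ε hε
    have huc : UniformContinuousOn (fun p : PathSp n h T × Set.Icc (-h) T => p.1 p.2)
        (D ×ˢ Set.univ) :=
      (hD.prod isCompact_univ).uniformContinuousOn_of_continuous
        (by fun_prop)
    rw [Metric.uniformContinuousOn_iff] at huc
    obtain ⟨δ1, hδ1, h1⟩ := huc (ε / 2) (half_pos hε)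
    obtain ⟨δ2, hδ2, h2⟩ := he (ε / 2 / (1 + R)) (by positivity)
    refine ⟨min (δ1 / 2) δ2, lt_min (by positivity) hδ2, ?_⟩
    rintro y hyY τ τ' hτ hττ hτ' hd
    have hyR := hYR y hyY
    obtain ⟨k, t0, ht0, x0, hx0, hy⟩ := hyY
    have hst := (stop_eq_iff hT hh ht0).1 hy.1
    have A1 : ∀ u v : ℝ, -h ≤ u → u ≤ v → v ≤ t0 → v - u ≤ min (δ1 / 2) δ2 →
        ‖evalP y v - evalP y u‖ ≤ ε / 2 := by
      intro u v hu huv hv huvd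
      rw [hst u (huv.trans hv), hst v hv]
      have := h1 (x0, ⟨v, hu.trans huv, hv.trans ht0.2⟩) ⟨hx0, mem_univ _⟩
        (x0, ⟨u, hu, (huv.trans hv).trans ht0.2⟩) ⟨hx0, mem_univ _⟩ (by
          rw [Prod.dist_eq, dist_self, Subtype.dist_eq, Real.dist_eq, abs_of_nonneg (by simpa using huv)]
          have := min_le_left (δ1 / 2) δ2
          simp only [max_lt_iff]
          exact ⟨hδ1, by linarith⟩)
      rw [dist_eq_norm] at this
      have e1 := evalP_coe hT hh x0 ⟨v, hu.trans huv, hv.trans ht0.2⟩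
      have e2 := evalP_coe hT hh x0 ⟨u, hu, (huv.trans hv).trans ht0.2⟩
      simp only at e1 e2 this
      rw [e1, e2]
      exact this.le
    have A2 : ∀ u v : ℝ, t0 ≤ u → u ≤ v → v ≤ T → v - u ≤ min (δ1 / 2) δ2 →
        ‖evalP y v - evalP y u‖ ≤ ε / 2 := by
      intro u v hu huv hv huvd
      have hv' : v ∈ Set.Icc 0 T := ⟨by linarith [ht0.1], hv⟩
      have b0 := (norm_stop_le hT hh hv' y).trans hyR
      have b1 := h2 k u v (by linarith [ht0.1]) huv hv (huvd.trans (min_le_right _ _))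
      have b2 := int_nonneg (hck k) (by linarith [ht0.1] : 0 ≤ u) huv hv
      calc ‖evalP y v - evalP y u‖ ≤ (1 + ‖stopPath v y‖) * ∫ ξ in u..v, c k ξ := hy.2 u v hu huv hv
        _ ≤ (1 + R) * (ε / 2 / (1 + R)) := by gcongr
        _ = ε / 2 := by field_simp
    rcases le_total τ' t0 with hc1 | hc1
    · linarith [A1 τ τ' hτ hττ hc1 hd]
    · rcases le_total t0 τ with hc2 | hc2
      · linarith [A2 τ τ' hc2 hττ hτ' hd]
      · have b1 := A1 τ t0 hτ hc2 le_rfl (by linarith)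
        have b2 := A2 t0 τ' le_rfl hc1 hτ' (by linarith)
        have := norm_sub_le_norm_sub_add_norm_sub (evalP y τ') (evalP y t0) (evalP y τ)
        linarith
  refine ⟨closure Y, ?_, fun k t0 ht0 x0 hx0 y hy => subset_closure ⟨k, t0, ht0, x0, hx0, hy⟩⟩
  let e := ContinuousMap.isometryEquivBoundedOfCompact (Set.Icc (-h) T) (Euc n)
  have hc : IsCompact (closure (e '' Y)) := by
    apply BoundedContinuousFunction.arzela_ascoli (Metric.closedBall 0 R)
      (isCompact_closedBall 0 R)
    · rintro f τ ⟨y, hy, rfl⟩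
      rw [mem_closedBall_zero_iff]
      exact (ContinuousMap.norm_coe_le_norm y τ).trans (hYR y hy)
    · apply UniformEquicontinuous.equicontinuous
      rw [Metric.uniformEquicontinuous_iff]
      intro ε hε
      obtain ⟨δ, hδ, hb⟩ := hequi (ε / 2) (half_pos hε)
      refine ⟨δ, hδ, ?_⟩
      rintro u v huv ⟨_, y, hy, rfl⟩
      show dist (y u) (y v) < ε
      rw [Subtype.dist_eq, Real.dist_eq] at huv
      rw [← evalP_coe hT hh, ← evalP_coe hT hh]
      rcases le_total u.1 v.1 with hc | hc
      · rw [dist_comm, dist_eq_norm]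
        rw [abs_sub_comm, abs_of_nonneg (by linarith)] at huv
        linarith [hb y hy u.1 v.1 u.2.1 hc v.2.2 huv.le]
      · rw [dist_eq_norm]
        rw [abs_of_nonneg (by linarith)] at huv
        linarith [hb y hy v.1 u.1 v.2.1 hc u.2.2 huv.le]
  rw [← e.toHomeomorph.isCompact_image, e.toHomeomorph.image_closure]
  exact hc

end cpt


section cauchy
variable {n : ℕ} {h T : ℝ}

lemma cauchy_half (hT : 0 < T) (hh : 0 ≤ h)
    {H : ℝ → PathSp n h T → Euc n → ℝ} {Hk : ℕ → ℝ → PathSp n h T → Euc n → ℝ}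
    {cH : ℝ → ℝ} {cHk : ℕ → ℝ → ℝ}
    {σ : PathSp n h T → ℝ} {σk : ℕ → PathSp n h T → ℝ}
    (hH : CondA H cH) (hσ : Continuous σ)
    (hHk : ∀ k, CondA (Hk k) (cHk k))
    (hcconv : Tendsto (fun k => L1dist T (cHk k) cH) atTop (nhds 0))
    (hHconv : ∀ D : Set (PathSp n h T), IsCompact D → ∀ s : Euc n, ∀ ε > (0:ℝ),
      ∃ N, ∀ k ≥ N, ∀ y ∈ D,
        (∫ t in Set.Icc (0:ℝ) T, |Hk k t y s - H t y s|) ≤ ε)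
    (hσconv : ∀ D : Set (PathSp n h T), IsCompact D → ∀ ε > (0:ℝ),
      ∃ N, ∀ k ≥ N, ∀ y ∈ D, |σk k y - σ y| ≤ ε)
    {φk : ℕ → ℝ → PathSp n h T → ℝ}
    (hφk : ∀ k, MinimaxSol (Hk k) (cHk k) (σk k) (φk k))
    {D : Set (PathSp n h T)} (hD : IsCompact D) {ρ : ℝ} (hρ : 0 < ρ) :
    ∃ N, ∀ k ≥ N, ∀ m ≥ N, ∀ t0 ∈ Set.Icc (0:ℝ) T, ∀ x0 ∈ D,
      φk m t0 x0 - φk k t0 x0 ≤ 9 * ρ := by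
  have hc := hH.2.2.2.1.1
  have hck : ∀ k, IntegNonneg T (cHk k) := fun k => (hHk k).2.2.2.1.1
  obtain ⟨D', hD', hW⟩ := W_compact hT hh hck (equi_seq hT hc hck hcconv) hD
  obtain ⟨A, hA0, hA, hA'⟩ := tot_bdd hT hc hck hcconv
  obtain ⟨R0, hR0⟩ := hD'.isBounded.exists_norm_le
  set R := |R0| with hRdef
  have hR : ∀ y ∈ D', ‖y‖ ≤ R := fun y hy => (hR0 y hy).trans (le_abs_self _)
  have hRn : 0 ≤ R := abs_nonneg _
  obtain ⟨lam, hlam⟩ := hH.2.2.1 D' hD'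
  set a : ℝ → ℝ := fun t => Real.exp (-(3 * ∫ ξ in (0:ℝ)..t, lam ξ)) with ha
  have h0m : (0:ℝ) ∈ Set.Icc 0 T := ⟨le_rfl, hT.le⟩
  have hTm : T ∈ Set.Icc 0 T := ⟨hT.le, le_rfl⟩
  have ha0 : ∀ t, 0 < a t := fun t => Real.exp_pos _
  have ha1 : ∀ t ∈ Set.Icc 0 T, a t ≤ 1 := by
    intro t ht
    have := int_nonneg hlam.1 le_rfl ht.1 ht.2
    exact Real.exp_le_one_iff.2 (by linarith)
  have haT : ∀ t ∈ Set.Icc 0 T, a T ≤ a t := by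
    intro t ht
    have := int_mono_set hlam.1 le_rfl le_rfl ht.1 ht.2 le_rfl
    exact Real.exp_le_exp.2 (by linarith)
  have hat : ∀ t ∈ Set.Icc 0 T, ∀ t' ∈ Set.Icc 0 T, t ≤ t' →
      a t' * (1 + 3 * ∫ ξ in t..t', lam ξ) ≤ a t := by
    intro t ht t' ht' htt
    have e := intervalIntegral.integral_add_adjacent_intervals (ii_of hlam.1.1 h0m ht)
      (ii_of hlam.1.1 ht ht')
    set Λ := ∫ ξ in t..t', lam ξ
    have e1 : a t = a t' * Real.exp (3 * Λ) := by
      simp only [ha]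
      rw [← Real.exp_add, ← e]
      congr 1; ring
    rw [e1]
    have := Real.add_one_le_exp (3 * Λ)
    have := ha0 t'
    gcongr
    linarith
  -- modulus of σ
  have hσu := hD'.uniformContinuousOn_of_continuous hσ.continuousOn
  rw [Metric.uniformContinuousOn_iff] at hσu
  obtain ⟨δ, hδ, hσu⟩ := hσu ρ hρ
  obtain ⟨b0, hb0⟩ := hD'.exists_bound_of_continuousOn hσ.continuousOn
  set b := |b0| with hb
  have hb' : ∀ y ∈ D', |σ y| ≤ b := fun y hy => (hb0 y hy).trans (le_abs_self _)
  have hbn : 0 ≤ b := abs_nonneg _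
  have haTp := ha0 T
  set K := (1 + 2 * b / δ) / a T with hK
  have hKp : 0 < K := by positivity
  have hKaT : K * a T = 1 + 2 * b / δ := by rw [hK]; field_simp
  have hKδ : 0 ≤ 2 * b / δ := by positivity
  have hσ2 : ∀ y1 ∈ D', ∀ y2 ∈ D', σ y2 - σ y1 ≤ ρ + K * a T * ‖y1 - y2‖ := by
    intro y1 h1 y2 h2
    have hn := norm_nonneg (y1 - y2)
    rw [hKaT]
    by_cases hlt : ‖y1 - y2‖ < δ
    · have := hσu y2 h2 y1 h1 (by rwa [dist_comm, dist_eq_norm])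
      rw [Real.dist_eq] at this
      have h3 := (le_abs_self _).trans this.le
      have : 0 ≤ (1 + 2 * b / δ) * ‖y1 - y2‖ := by positivity
      linarith
    · push Not at hlt
      have h3 : (2 * b / δ) * δ ≤ (1 + 2 * b / δ) * ‖y1 - y2‖ := by
        gcongr
        linarith
      have h4 : (2 * b / δ) * δ = 2 * b := by field_simp
      have h5 := (le_abs_self _).trans (hb' y2 h2)
      have h6 := (neg_le_abs _).trans (hb' y1 h1)
      linarith
  set ε := ρ / (2 * K) with hε
  have hεp : 0 < ε := by positivity
  have hKε : 2 * K * ε = ρ := by rw [hε]; field_simp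
  set η := ρ / (2 * A * (1 + R) + 1) with hη
  have hηp : 0 < η := by positivity
  have hηA : (A + A) * ((1 + R) * η) ≤ ρ := by
    rw [hη]
    have e : (A + A) * ((1 + R) * (ρ / (2 * A * (1 + R) + 1))) =
      (2 * A * (1 + R)) * ρ / (2 * A * (1 + R) + 1) := by field_simp; ring
    rw [e, div_le_iff₀ (by positivity)]
    nlinarith
  obtain ⟨S0, hS0s, hS0f, hS0⟩ := (isCompact_closedBall (0 : Euc n) (2 * K)).finite_cover_balls hηp
  set S := hS0f.toFinset with hS
  have hSnet : ∀ s : Euc n, ‖s‖ ≤ 2 * K → ∃ s' ∈ S, ‖s - s'‖ ≤ η := by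
    intro s hs
    have := hS0 (mem_closedBall_zero_iff.2 hs)
    simp only [mem_iUnion, Metric.mem_ball, exists_prop] at this
    obtain ⟨s', h1, h2⟩ := this
    exact ⟨s', by simpa [hS] using h1, by rw [← dist_eq_norm]; exact h2.le⟩
  have hev1 : ∀ᶠ k in atTop, ∀ s ∈ S, ∀ y ∈ D',
      (∫ t in Set.Icc (0:ℝ) T, |Hk k t y s - H t y s|) ≤ ρ / (S.card + 1) := by
    rw [Filter.eventually_all_finset]
    intro s _
    exact eventually_atTop.2 (hHconv D' hD' s _ (by positivity))
  have hev2 : ∀ᶠ k in atTop, ∀ y ∈ D', |σk k y - σ y| ≤ ρ :=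
    eventually_atTop.2 (hσconv D' hD' ρ hρ)
  obtain ⟨N, hN⟩ := eventually_atTop.1 (hev1.and hev2)
  refine ⟨N, fun k hk m hm t0 ht0 x0 hx0 => ?_⟩
  have g : GD H (Hk k) (Hk m) cH (cHk k) (cHk m) (φk k) (φk m) t0 x0 D' R lam S η K a ε :=
    { hH := hH, hH1 := hHk k, hH2 := hHk m, U := (hφk k).1.2.2.2, L := (hφk m).2.2.2.2
      na1 := (hφk k).1.1, na2 := (hφk m).1.1, ht0 := ht0, D1 := hW k t0 ht0 x0 hx0
      D2 := hW m t0 ht0 x0 hx0, hR := hR, hR0 := hRn, hlam := hlam, hS := hSnet, hη := hηp.le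
      hK := hKp, ha0 := fun t _ => ha0 t, ha1 := ha1
      hKa := fun t ht => by
        have h1 := haT t ht
        have h2 : K * a T ≤ K * a t := by gcongr
        linarith
      hat := hat, hε := hεp }
  obtain ⟨y1, hy1, y2, hy2, hI⟩ := game_run hT hh g hρ
  have hy1 := hW k t0 ht0 x0 hx0 hy1
  have hy2 := hW m t0 ht0 x0 hx0 hy2
  have herr : ∀ j ≥ N, ∀ y ∈ D',
      ∫ ξ in Set.Icc 0 T, errF (Hk j) H (cHk j) cH S ((1 + R) * η) y ξ ≤ 2 * ρ := by
    intro j hj y hy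
    rw [errF_integral hT hh (hHk j) hH]
    have e1 : ∑ s ∈ S, (∫ ξ in Set.Icc 0 T, |Hk j ξ y s - H ξ y s|) ≤ ρ := by
      refine (Finset.sum_le_card_nsmul S _ _ (fun s hs => (hN j hj).1 s hs y hy)).trans ?_
      rw [nsmul_eq_mul, mul_div_assoc', div_le_iff₀ (by positivity)]
      nlinarith
    have e2 : ((∫ ξ in Set.Icc 0 T, cHk j ξ) + ∫ ξ in Set.Icc 0 T, cH ξ) * ((1 + R) * η) ≤ ρ := by
      refine le_trans ?_ hηA
      have := hA j
      gcongr
    linarith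
  have f1 := herr k hk y1 hy1
  have f2 := herr m hm y2 hy2
  have f3 := hσ2 y1 hy1 y2 hy2
  have f4 := abs_le.1 ((hN k hk).2 y1 hy1)
  have f5 := abs_le.1 ((hN m hm).2 y2 hy2)
  have f6 := (hφk k).1.2.2.1 y1
  have f7 := (hφk m).2.2.2.1 y2
  linarith [f4.1, f4.2, f5.1, f5.2]

end cauchy


section wy
variable {n : ℕ} {h T : ℝ}

lemma ac_of_bound {f c : ℝ → ℝ} {t T C : ℝ} (htT : t ≤ T) (hc : IntervalIntegrable c volume t T)
    (hf : ∀ a b, t ≤ a → a ≤ b → b ≤ T → |f b - f a| ≤ C * ∫ ξ in a..b, c ξ) :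
    AbsolutelyContinuousOnInterval f t T := by
  have hF := (hc.absolutelyContinuousOnInterval_intervalIntegral
    (left_mem_uIcc : t ∈ uIcc t T)).const_mul C
  have key : ∀ a b, t ≤ a → a ≤ b → b ≤ T → dist (f a) (f b) ≤
      dist (C * ∫ v in t..a, c v) (C * ∫ v in t..b, c v) := by
    intro a b ha hab hb
    have i1 : IntervalIntegrable c volume t a := hc.mono_set (by
      rw [uIcc_of_le ha, uIcc_of_le htT]; exact Icc_subset_Icc le_rfl (hab.trans hb))
    have i2 : IntervalIntegrable c volume t b := hc.mono_set (by
      rw [uIcc_of_le (ha.trans hab), uIcc_of_le htT]; exact Icc_subset_Icc le_rfl hb)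
    rw [dist_comm, Real.dist_eq, dist_comm, Real.dist_eq, ← mul_sub,
      intervalIntegral.integral_interval_sub_left i2 i1]
    exact (hf a b ha hab hb).trans (le_abs_self _)
  unfold AbsolutelyContinuousOnInterval at hF ⊢
  refine squeeze_zero' (Eventually.of_forall fun E => Finset.sum_nonneg fun i _ => dist_nonneg) ?_ hF
  refine Filter.Eventually.filter_mono inf_le_right ?_
  rw [Filter.eventually_principal]
  intro E hE
  apply Finset.sum_le_sum
  intro i hi
  have hm := hE.1 i hi
  rw [uIcc_of_le htT] at hm
  rcases le_total (E.2 i).1 (E.2 i).2 with hle | hle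
  · exact key _ _ hm.1.1 hle hm.2.2
  · rw [dist_comm, dist_comm (C * _)]
    exact key _ _ hm.2.1 hle hm.1.2

lemma W_YPair (hT : 0 < T) (hh : 0 ≤ h) {t : ℝ} (ht : t ∈ Set.Icc 0 T) {x : PathSp n h T}
    {c : ℝ → ℝ} (hc : IntegNonneg T c) {y : PathSp n h T} (hy : y ∈ WSet t x c) :
    ∃ y', (y, y') ∈ YPair t x c := by
  have hTm : T ∈ Set.Icc 0 T := ⟨hT.le, le_rfl⟩
  have htT := ht.2
  have ic : IntervalIntegrable c volume t T := ii_of hc.1 ht hTm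
  have hbd : ∀ a b, t ≤ a → a ≤ b → b ≤ T →
      ‖evalP y b - evalP y a‖ ≤ (1 + ‖y‖) * ∫ ξ in a..b, c ξ := by
    intro a b ha hab hb
    refine (hy.2 a b ha hab hb).trans ?_
    have h1 := int_nonneg hc (ht.1.trans ha) hab hb
    have h2 := norm_stop_le hT hh (t := b) ⟨by linarith [ht.1], hb⟩ y
    gcongr
  let f : Fin n → ℝ → ℝ := fun i τ => evalP y τ i
  have hac : ∀ i, AbsolutelyContinuousOnInterval (f i) t T := by
    intro i
    refine ac_of_bound htT ic (C := 1 + ‖y‖) (fun a b ha hab hb => ?_)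
    refine le_trans ?_ (hbd a b ha hab hb)
    have := EuclideanSpace.norm_eq (evalP y b - evalP y a)
    have h2 := PiLp.norm_apply_le (evalP y b - evalP y a) i
    simpa [f] using h2
  let y' : ℝ → Euc n := fun τ => ∑ i, deriv (f i) τ • EuclideanSpace.single i (1:ℝ)
  have hyrep : ∀ v : Euc n, v = ∑ i, v i • EuclideanSpace.single i (1:ℝ) := by
    intro v
    ext j
    simp [Finset.sum_apply, Pi.single_apply]
  have hy'i : ∀ τ i, y' τ i = deriv (f i) τ := by
    intro τ j
    simp [y', Finset.sum_apply, Pi.single_apply]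
  have iy' : IntervalIntegrable y' volume t T := by
    have : y' = ∑ i, fun τ => deriv (f i) τ • EuclideanSpace.single i (1:ℝ) := by
      funext τ; simp [y', Finset.sum_apply]
    rw [this]
    apply IntervalIntegrable.sum
    intro i _
    have := (hac i).intervalIntegrable_deriv
    exact ⟨this.1.smul_const _, this.2.smul_const _⟩
  refine ⟨y', ⟨hy.1, iy', fun τ hτ => ?_⟩, ?_⟩
  · have i1 : IntervalIntegrable y' volume t τ := iy'.mono_set (by
      rw [uIcc_of_le hτ.1, uIcc_of_le htT]; exact Icc_subset_Icc le_rfl hτ.2)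
    ext j
    have e1 : ∫ ξ in t..τ, (y' ξ) j = (∫ ξ in t..τ, y' ξ) j :=
      (EuclideanSpace.proj (𝕜 := ℝ) j).intervalIntegral_comp_comm i1
    have e2 := ((hac j).mono (c := t) (d := τ) (by
      rw [uIcc_of_le hτ.1, uIcc_of_le htT]; exact Icc_subset_Icc le_rfl hτ.2)).integral_deriv_eq_sub
    simp only [hy'i] at e1
    rw [PiLp.add_apply, ← e1, e2]
    simp [f]
  · have hdiff : ∀ᵐ τ, ∀ i, τ ∈ uIcc t T → DifferentiableAt ℝ (f i) τ := by
      rw [ae_all_iff]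
      exact fun i => (hac i).ae_differentiableAt
    have hneT : ∀ᵐ τ : ℝ, τ ≠ T := by simp [ae_iff, measure_singleton]
    rw [ae_restrict_iff' measurableSet_Icc]
    filter_upwards [hdiff, hneT, ic.ae_hasDerivAt_integral] with τ h1 h2 h3 hτ
    rw [uIcc_of_le htT] at h1 h3
    have hlt : τ < T := lt_of_le_of_ne hτ.2 h2
    have hτ0 : τ ∈ Set.Icc 0 T := ⟨ht.1.trans hτ.1, hτ.2⟩
    have hF := h3 hτ t ⟨le_rfl, htT⟩
    set F : ℝ → ℝ := fun x => ∫ v in t..x, c v with hFd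
    have hdy : HasDerivAt (evalP y) (y' τ) τ := by
      have : evalP y = fun τ => ∑ i, f i τ • EuclideanSpace.single i (1:ℝ) := by
        funext τ; exact hyrep _
      rw [this]
      exact HasDerivAt.fun_sum (fun i _ => ((h1 i hτ).hasDerivAt).smul_const _)
    have s1 : Tendsto (fun b => ‖slope (evalP y) τ b‖) (𝓝[>] τ) (𝓝 ‖y' τ‖) :=
      ((hasDerivAt_iff_tendsto_slope.1 hdy).mono_left
        (nhdsWithin_mono _ (fun z hz => ne_of_gt hz))).norm
    have s2 : Tendsto (slope F τ) (𝓝[>] τ) (𝓝 (c τ)) :=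
      (hasDerivAt_iff_tendsto_slope.1 hF).mono_left
        (nhdsWithin_mono _ (fun z hz => ne_of_gt hz))
    have s3 : Tendsto F (𝓝[>] τ) (𝓝 (F τ)) := hF.continuousAt.tendsto.mono_left nhdsWithin_le_nhds
    have s4 : Tendsto (fun b => slope F τ b * (1 + ‖stopPath τ y‖ + (1 + ‖y‖) * (F b - F τ)))
        (𝓝[>] τ) (𝓝 (c τ * (1 + ‖stopPath τ y‖ + (1 + ‖y‖) * (F τ - F τ)))) :=
      s2.mul (tendsto_const_nhds.add (tendsto_const_nhds.mul (s3.sub tendsto_const_nhds)))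
    rw [sub_self, mul_zero, add_zero] at s4
    refine le_of_tendsto_of_tendsto s1 s4 ?_
    filter_upwards [Ioc_mem_nhdsGT hlt] with b hb
    have hb0 : b ∈ Set.Icc 0 T := ⟨hτ0.1.trans hb.1.le, hb.2⟩
    have eF : ∀ b ∈ Set.Icc τ T, F b - F τ = ∫ ξ in τ..b, c ξ := fun b hb =>
      intervalIntegral.integral_interval_sub_left (ii_of hc.1 ht ⟨hτ0.1.trans hb.1, hb.2⟩)
        (ii_of hc.1 ht hτ0)
    have b1 := hy.2 τ b hτ.1 hb.1.le hb.2
    rw [← eF b ⟨hb.1.le, hb.2⟩] at b1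
    have hF0 : 0 ≤ F b - F τ := by
      rw [eF b ⟨hb.1.le, hb.2⟩]; exact int_nonneg hc hτ0.1 hb.1.le hb.2
    have b2 := norm_stop_le_add hT hh hτ0 hb0 y (d := (1 + ‖y‖) * (F b - F τ)) (by positivity) (by
      intro ξ hξ
      refine (hbd τ ξ hτ.1 hξ.1 (hξ.2.trans hb.2)).trans ?_
      rw [eF b ⟨hb.1.le, hb.2⟩]
      have := int_mono_set hc hτ0.1 le_rfl hξ.1 hξ.2 hb.2
      gcongr)
    have hpos : 0 < b - τ := by linarith [hb.1]
    rw [slope_def_module, slope_def_field, norm_smul, norm_inv, Real.norm_of_nonneg hpos.le]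
    rw [div_mul_eq_mul_div, inv_mul_eq_div]
    gcongr
    refine b1.trans ?_
    rw [mul_comm]
    exact mul_le_mul_of_nonneg_left (by linarith) hF0

end wy


section lim
variable {n : ℕ} {h T : ℝ}

lemma continuous_stopd (hT : 0 < T) (hh : 0 ≤ h) {t : ℝ} (ht : t ∈ Set.Icc 0 T) :
    Continuous (fun x : PathSp n h T => stopPath t x) := by
  have : LipschitzWith 1 (fun x : PathSp n h T => stopPath t x) := by
    apply LipschitzWith.of_dist_le_mul
    intro x y
    rw [dist_eq_norm, dist_eq_norm, ← stop_sub]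
    simpa using norm_stop_le hT hh ht (x - y)
  exact this.continuous

lemma continuous_evalPx (hT : 0 < T) (hh : 0 ≤ h) (τ : ℝ) :
    Continuous (fun x : PathSp n h T => evalP x τ) := by
  have : (fun x : PathSp n h T => evalP x τ) =
      fun x => x (Set.projIcc (-h) T (by linarith) τ) := by
    funext x; exact evalP_eq hT hh x τ
  rw [this]
  fun_prop

lemma W_limit (hT : 0 < T) (hh : 0 ≤ h) {cH : ℝ → ℝ} {c : ℕ → ℝ → ℝ} (hc : IntegNonneg T cH)
    (hck : ∀ k, IntegNonneg T (c k))
    (hconv : Tendsto (fun k => L1dist T (c k) cH) atTop (nhds 0)) {t : ℝ} (ht : t ∈ Set.Icc 0 T)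
    {x : PathSp n h T} {z : ℕ → PathSp n h T} (hz : ∀ k, z k ∈ WSet t x (c k)) {y : PathSp n h T}
    (hy : Tendsto z atTop (𝓝 y)) : y ∈ WSet t x cH := by
  constructor
  · have h1 := ((continuous_stopd hT hh ht).tendsto y).comp hy
    have h2 : (fun x => stopPath t x) ∘ z = fun _ => stopPath t x := by
      funext k; exact (hz k).1
    rw [h2] at h1
    exact tendsto_nhds_unique h1 tendsto_const_nhds
  · intro a b ha hab hb
    have hb' : b ∈ Set.Icc 0 T := ⟨by linarith [ht.1], hb⟩
    have l1 : Tendsto (fun k => ‖evalP (z k) b - evalP (z k) a‖) atTop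
        (𝓝 ‖evalP y b - evalP y a‖) :=
      (((continuous_evalPx hT hh b).tendsto y).comp hy |>.sub
        (((continuous_evalPx hT hh a).tendsto y).comp hy)).norm
    have l2 : Tendsto (fun k => (1 + ‖stopPath b (z k)‖) * ((∫ ξ in a..b, cH ξ) + L1dist T (c k) cH))
        atTop (𝓝 ((1 + ‖stopPath b y‖) * ((∫ ξ in a..b, cH ξ) + 0))) :=
      (tendsto_const_nhds.add (((continuous_stopd hT hh hb').tendsto y).comp hy).norm).mul
        (tendsto_const_nhds.add hconv)
    rw [add_zero] at l2
    refine le_of_tendsto_of_tendsto' l1 l2 (fun k => ((hz k).2 a b ha hab hb).trans ?_)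
    have := int_le_L1 hT (hck k) hc (ht.1.trans ha) hab hb
    gcongr

lemma H_int_bound (hT : 0 < T) (hh : 0 ≤ h) {H1 H : ℝ → PathSp n h T → Euc n → ℝ}
    {c1 cH : ℝ → ℝ} (hH1 : CondA H1 c1) (hH : CondA H cH) {D : Set (PathSp n h T)} {lam : ℝ → ℝ}
    (hlam : CondA3For H D lam) {z y : PathSp n h T} (hz : z ∈ D) (hy : y ∈ D) (s : Euc n)
    {t τ : ℝ} (ht : t ∈ Set.Icc 0 T) (hτ : τ ∈ Set.Icc 0 T) (htτ : t ≤ τ) :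
    |(∫ ξ in t..τ, H1 ξ z s) - ∫ ξ in t..τ, H ξ y s| ≤
      (∫ ξ in Set.Icc 0 T, |H1 ξ z s - H ξ z s|) +
        (∫ ξ in Set.Icc 0 T, lam ξ) * ((1 + ‖s‖) * ‖z - y‖) := by
  have i1 := H_integrable hT hh hH1 z s
  have i2 := H_integrable hT hh hH z s
  have i3 := H_integrable hT hh hH y s
  have iA : IntegrableOn (fun ξ => |H1 ξ z s - H ξ z s|) (Set.Icc 0 T) := (i1.sub i2).abs
  have iB : IntegrableOn (fun ξ => lam ξ * ((1 + ‖s‖) * ‖z - y‖)) (Set.Icc 0 T) :=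
    hlam.1.1.mul_const _
  have hG : IntegNonneg T (fun ξ => |H1 ξ z s - H ξ z s| + lam ξ * ((1 + ‖s‖) * ‖z - y‖)) := by
    refine ⟨iA.add iB, fun ξ hξ => ?_⟩
    have := hlam.1.2 ξ hξ
    positivity
  rw [← intervalIntegral.integral_sub (ii_of i1 ht hτ) (ii_of i3 ht hτ)]
  calc |∫ ξ in t..τ, (H1 ξ z s - H ξ y s)| ≤ ∫ ξ in t..τ, |H1 ξ z s - H ξ y s| :=
        intervalIntegral.abs_integral_le_integral_abs htτ
    _ ≤ ∫ ξ in t..τ, (|H1 ξ z s - H ξ z s| + lam ξ * ((1 + ‖s‖) * ‖z - y‖)) := by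
        refine intervalIntegral.integral_mono_ae_restrict htτ
          ((ii_of i1 ht hτ).sub (ii_of i3 ht hτ)).abs (ii_of hG.1 ht hτ) ?_
        filter_upwards [ae_sub (A3_ae hT hh hH.1 hlam hz hy s) ht hτ,
          ae_restrict_mem measurableSet_Icc] with ξ a1 hξ
        have hξT : ξ ∈ Set.Icc 0 T := ⟨ht.1.trans hξ.1, hξ.2.trans hτ.2⟩
        have h1 := norm_stop_le hT hh hξT (z - y)
        have h2 := hlam.1.2 ξ hξT
        have h3 : lam ξ * (1 + ‖s‖) * ‖stopPath ξ (z - y)‖ ≤ lam ξ * ((1 + ‖s‖) * ‖z - y‖) := by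
          rw [mul_assoc]; gcongr
        have h4 := abs_sub_le (H1 ξ z s) (H ξ z s) (H ξ y s)
        show |H1 ξ z s - H ξ y s| ≤ |H1 ξ z s - H ξ z s| + lam ξ * ((1 + ‖s‖) * ‖z - y‖)
        linarith
    _ ≤ ∫ ξ in Set.Icc 0 T, (|H1 ξ z s - H ξ z s| + lam ξ * ((1 + ‖s‖) * ‖z - y‖)) :=
        int_le_set hT hG ht.1 htτ hτ.2
    _ = _ := by rw [integral_add iA iB, integral_mul_const]

lemma cont_limit (hT : 0 < T) {φk : ℕ → ℝ → PathSp n h T → ℝ} {φ : ℝ → PathSp n h T → ℝ}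
    (hk : ∀ k, ContinuousOn (fun p : ℝ × PathSp n h T => φk k p.1 p.2)
      (Set.Icc 0 T ×ˢ (Set.univ : Set (PathSp n h T))))
    (hu : ∀ D : Set (PathSp n h T), IsCompact D → ∀ ε > (0:ℝ),
        ∃ N, ∀ k ≥ N, ∀ t ∈ Set.Icc (0:ℝ) T, ∀ x ∈ D, |φk k t x - φ t x| ≤ ε) :
    ContinuousOn (fun p : ℝ × PathSp n h T => φ p.1 p.2)
      (Set.Icc 0 T ×ˢ (Set.univ : Set (PathSp n h T))) := by
  have hD : ∀ D : Set (PathSp n h T), IsCompact D →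
      ContinuousOn (fun p : ℝ × PathSp n h T => φ p.1 p.2) (Set.Icc 0 T ×ˢ D) := by
    intro D hD
    have : TendstoUniformlyOn (fun k (p : ℝ × PathSp n h T) => φk k p.1 p.2)
        (fun p => φ p.1 p.2) atTop (Set.Icc 0 T ×ˢ D) := by
      rw [Metric.tendstoUniformlyOn_iff]
      intro ε hε
      obtain ⟨N, hN⟩ := hu D hD (ε / 2) (half_pos hε)
      filter_upwards [eventually_ge_atTop N] with k hk p hp
      rw [dist_comm, Real.dist_eq]
      linarith [hN k hk p.1 hp.1 p.2 hp.2]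
    exact this.continuousOn (Eventually.frequently (Eventually.of_forall fun k =>
      (hk k).mono (Set.prod_mono le_rfl (subset_univ _))))
  intro p hp
  unfold ContinuousWithinAt
  apply tendsto_of_seq_tendsto
  intro u hu'
  rw [tendsto_nhdsWithin_iff] at hu'
  have h2 : Tendsto (fun j => (u j).2) atTop (𝓝 p.2) := (continuous_snd.tendsto p).comp hu'.1
  have hK := h2.isCompact_insert_range
  have := hD _ hK p ⟨hp.1, mem_insert _ _⟩
  refine this.tendsto.comp (tendsto_nhdsWithin_iff.2 ⟨hu'.1, ?_⟩)
  filter_upwards [hu'.2] with j hj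
  exact ⟨hj.1, mem_insert_of_mem _ ⟨j, rfl⟩⟩

lemma lim_prop (hT : 0 < T) (hh : 0 ≤ h)
    {H : ℝ → PathSp n h T → Euc n → ℝ} {Hk : ℕ → ℝ → PathSp n h T → Euc n → ℝ}
    {cH : ℝ → ℝ} {cHk : ℕ → ℝ → ℝ}
    (hH : CondA H cH)
    (hHk : ∀ k, CondA (Hk k) (cHk k))
    (hcconv : Tendsto (fun k => L1dist T (cHk k) cH) atTop (nhds 0))
    (hHconv : ∀ D : Set (PathSp n h T), IsCompact D → ∀ s : Euc n, ∀ ε > (0:ℝ),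
      ∃ N, ∀ k ≥ N, ∀ y ∈ D,
        (∫ t in Set.Icc (0:ℝ) T, |Hk k t y s - H t y s|) ≤ ε)
    {φk : ℕ → ℝ → PathSp n h T → ℝ} {φ : ℝ → PathSp n h T → ℝ}
    (hu : ∀ D : Set (PathSp n h T), IsCompact D → ∀ ε > (0:ℝ),
        ∃ N, ∀ k ≥ N, ∀ t ∈ Set.Icc (0:ℝ) T, ∀ x ∈ D, |φk k t x - φ t x| ≤ ε)
    (hφ : ContinuousOn (fun p : ℝ × PathSp n h T => φ p.1 p.2)
      (Set.Icc 0 T ×ˢ (Set.univ : Set (PathSp n h T))))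
    {t τ : ℝ} (ht : t ∈ Set.Ico 0 T) (hτ : τ ∈ Set.Ioc t T) (x : PathSp n h T) (s : Euc n)
    (p : ℕ → PathSp n h T × (ℝ → Euc n)) (hp : ∀ k, p k ∈ YPair t x (cHk k)) :
    ∃ q ∈ YPair t x cH, ∃ ψ : ℕ → ℕ, StrictMono ψ ∧
      Tendsto (fun j => φk (ψ j) τ (p (ψ j)).1 -
        ∫ ξ in t..τ, (@inner ℝ _ _ s ((p (ψ j)).2 ξ) - Hk (ψ j) ξ (p (ψ j)).1 s)) atTop
        (𝓝 (φ τ q.1 - ∫ ξ in t..τ, (@inner ℝ _ _ s (q.2 ξ) - H ξ q.1 s))) := by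
  have hc := hH.2.2.2.1.1
  have hck : ∀ k, IntegNonneg T (cHk k) := fun k => (hHk k).2.2.2.1.1
  have htm : t ∈ Set.Icc 0 T := ⟨ht.1, ht.2.le⟩
  have hτm : τ ∈ Set.Icc 0 T := ⟨ht.1.trans hτ.1.le, hτ.2⟩
  have htτ : τ ∈ Set.Icc t T := ⟨hτ.1.le, hτ.2⟩
  obtain ⟨D', hD', hW⟩ := W_compact hT hh hck (equi_seq hT hc hck hcconv)
    (isCompact_singleton (x := x))
  have hpW : ∀ k, (p k).1 ∈ WSet t x (cHk k) := fun k => YPair_W hT hh htm (hck k) (hp k)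
  have hpD : ∀ k, (p k).1 ∈ D' := fun k => hW k t htm x rfl (hpW k)
  obtain ⟨y, hyD, ψ, hψ, hlim⟩ := hD'.tendsto_subseq hpD
  have hψ' := hψ.tendsto_atTop
  have hyW : y ∈ WSet t x cH := W_limit hT hh hc (fun j => hck (ψ j)) (hcconv.comp hψ') htm
    (fun j => hpW (ψ j)) hlim
  obtain ⟨y', hy'⟩ := W_YPair hT hh htm hc hyW
  refine ⟨(y, y'), hy', ψ, hψ, ?_⟩
  obtain ⟨lam, hlam⟩ := hH.2.2.1 D' hD'
  -- the φ term
  have l1 : Tendsto (fun j => φk (ψ j) τ (p (ψ j)).1) atTop (𝓝 (φ τ y)) := by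
    have a1 : Tendsto (fun j => φ τ (p (ψ j)).1) atTop (𝓝 (φ τ y)) := by
      have := (hφ (τ, y) ⟨hτm, mem_univ _⟩).tendsto
      refine this.comp (tendsto_nhdsWithin_iff.2 ⟨?_, ?_⟩) (x := atTop)
        (f := fun j => (τ, (p (ψ j)).1))
      · exact tendsto_const_nhds.prodMk_nhds hlim
      · exact Eventually.of_forall fun j => ⟨hτm, mem_univ _⟩
    have a2 : Tendsto (fun j => φk (ψ j) τ (p (ψ j)).1 - φ τ (p (ψ j)).1) atTop (𝓝 0) := by
      rw [Metric.tendsto_atTop]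
      intro ε hε
      obtain ⟨N, hN⟩ := hu D' hD' (ε / 2) (half_pos hε)
      refine ⟨N, fun j hj => ?_⟩
      rw [Real.dist_eq, sub_zero]
      linarith [hN (ψ j) (hj.trans (hψ.id_le j)) τ hτm _ (hpD (ψ j))]
    simpa using a2.add a1
  have l2 : Tendsto (fun j => @inner ℝ _ _ s (evalP (p (ψ j)).1 τ - evalP (p (ψ j)).1 t)) atTop
      (𝓝 (@inner ℝ _ _ s (evalP y τ - evalP y t))) := by
    apply Tendsto.inner tendsto_const_nhds
    exact (((continuous_evalPx hT hh τ).tendsto y).comp hlim).sub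
      (((continuous_evalPx hT hh t).tendsto y).comp hlim)
  have l3 : Tendsto (fun j => ∫ ξ in t..τ, Hk (ψ j) ξ (p (ψ j)).1 s) atTop
      (𝓝 (∫ ξ in t..τ, H ξ y s)) := by
    rw [tendsto_iff_norm_sub_tendsto_zero]
    have b1 : Tendsto (fun j => ∫ ξ in Set.Icc 0 T, |Hk (ψ j) ξ (p (ψ j)).1 s - H ξ (p (ψ j)).1 s|)
        atTop (𝓝 0) := by
      rw [Metric.tendsto_atTop]
      intro ε hε
      obtain ⟨N, hN⟩ := hHconv D' hD' s (ε / 2) (half_pos hε)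
      refine ⟨N, fun j hj => ?_⟩
      rw [Real.dist_eq, sub_zero, abs_of_nonneg (integral_nonneg fun _ => abs_nonneg _)]
      linarith [hN (ψ j) (hj.trans (hψ.id_le j)) _ (hpD (ψ j))]
    have b2 : Tendsto (fun j => ‖(p (ψ j)).1 - y‖) atTop (𝓝 0) :=
      tendsto_iff_norm_sub_tendsto_zero.1 hlim
    have b3 := b1.add ((b2.const_mul (1 + ‖s‖)).const_mul (∫ ξ in Set.Icc 0 T, lam ξ))
    simp only [mul_zero, add_zero] at b3
    exact squeeze_zero (fun _ => norm_nonneg _)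
      (fun j => H_int_bound hT hh (hHk (ψ j)) hH hlam (hpD (ψ j)) hyD s htm hτm hτ.1.le) b3
  have e1 : ∀ j, ∫ ξ in t..τ, (@inner ℝ _ _ s ((p (ψ j)).2 ξ) - Hk (ψ j) ξ (p (ψ j)).1 s) =
      @inner ℝ _ _ s (evalP (p (ψ j)).1 τ - evalP (p (ψ j)).1 t) -
        ∫ ξ in t..τ, Hk (ψ j) ξ (p (ψ j)).1 s := by
    intro j
    have := ACPair_inner (hp (ψ j)).1 htτ s
    rw [intervalIntegral.integral_sub this.1
      (ii_of (H_integrable hT hh (hHk (ψ j)) _ s) htm hτm), this.2]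
  have e2 : ∫ ξ in t..τ, (@inner ℝ _ _ s (y' ξ) - H ξ y s) =
      @inner ℝ _ _ s (evalP y τ - evalP y t) - ∫ ξ in t..τ, H ξ y s := by
    have := ACPair_inner hy'.1 htτ s
    rw [intervalIntegral.integral_sub this.1
      (ii_of (H_integrable hT hh hH _ s) htm hτm), this.2]
  simp only [e1]
  rw [e2]
  exact l1.sub (l2.sub l3)

end lim

/-- stability: if `H_k → H` in the integral sense (uniformly
on compacts in `x`, for every `s`), `σ_k → σ` uniformly on compacts and
`c_{H_k} → c_H` in `L¹`, and minimax solutions `φ_k` exist for every `k`, then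
a minimax solution `φ` for `(H,σ)` exists and `φ_k → φ` uniformly on
`[0,T] × D` for every compact `D`. -/
theorem stmt14 {n : ℕ} {h T : ℝ} (hT : 0 < T) (hh : 0 ≤ h)
    (H : ℝ → PathSp n h T → Euc n → ℝ) (Hk : ℕ → ℝ → PathSp n h T → Euc n → ℝ)
    (cH : ℝ → ℝ) (cHk : ℕ → ℝ → ℝ)
    (σ : PathSp n h T → ℝ) (σk : ℕ → PathSp n h T → ℝ)
    (hH : CondA H cH) (hσ : Continuous σ)
    (hHk : ∀ k, CondA (Hk k) (cHk k)) (hσk : ∀ k, Continuous (σk k))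
    (hcconv : Tendsto (fun k => L1dist T (cHk k) cH) atTop (nhds 0))
    (hHconv : ∀ D : Set (PathSp n h T), IsCompact D → ∀ s : Euc n, ∀ ε > (0:ℝ),
      ∃ N, ∀ k ≥ N, ∀ y ∈ D,
        (∫ t in Set.Icc (0:ℝ) T, |Hk k t y s - H t y s|) ≤ ε)
    (hσconv : ∀ D : Set (PathSp n h T), IsCompact D → ∀ ε > (0:ℝ),
      ∃ N, ∀ k ≥ N, ∀ y ∈ D, |σk k y - σ y| ≤ ε)
    (φk : ℕ → ℝ → PathSp n h T → ℝ)
    (hφk : ∀ k, MinimaxSol (Hk k) (cHk k) (σk k) (φk k)) :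
    ∃ φ : ℝ → PathSp n h T → ℝ, MinimaxSol H cH σ φ ∧
      ∀ D : Set (PathSp n h T), IsCompact D → ∀ ε > (0:ℝ),
        ∃ N, ∀ k ≥ N, ∀ t ∈ Set.Icc (0:ℝ) T, ∀ x ∈ D,
          |φk k t x - φ t x| ≤ ε := by
  have hCau : ∀ D : Set (PathSp n h T), IsCompact D → ∀ ε > (0:ℝ),
      ∃ N, ∀ k ≥ N, ∀ m ≥ N, ∀ t ∈ Set.Icc (0:ℝ) T, ∀ x ∈ D, |φk k t x - φk m t x| ≤ ε := by
    intro D hD ε hε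
    obtain ⟨N, hN⟩ := cauchy_half hT hh hH hσ hHk hcconv hHconv hσconv hφk hD
      (ρ := ε / 9) (by positivity)
    refine ⟨N, fun k hk m hm t ht x hx => ?_⟩
    have h1 := hN k hk m hm t ht x hx
    have h2 := hN m hm k hk t ht x hx
    rw [abs_le]
    constructor <;> linarith
  have hlim : ∀ t x, ∃ l : ℝ, t ∈ Set.Icc (0:ℝ) T → Tendsto (fun k => φk k t x) atTop (𝓝 l) := by
    intro t x
    by_cases ht : t ∈ Set.Icc (0:ℝ) T
    · have hc : CauchySeq (fun k => φk k t x) := by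
        rw [Metric.cauchySeq_iff]
        intro ε hε
        obtain ⟨N, hN⟩ := hCau {x} isCompact_singleton (ε / 2) (half_pos hε)
        refine ⟨N, fun k hk m hm => ?_⟩
        rw [Real.dist_eq]
        linarith [hN k hk m hm t ht x rfl]
      obtain ⟨l, hl⟩ := cauchySeq_tendsto_of_complete hc
      exact ⟨l, fun _ => hl⟩
    · exact ⟨0, fun h => absurd h ht⟩
  choose φ hφl using hlim
  have hu : ∀ D : Set (PathSp n h T), IsCompact D → ∀ ε > (0:ℝ),
        ∃ N, ∀ k ≥ N, ∀ t ∈ Set.Icc (0:ℝ) T, ∀ x ∈ D, |φk k t x - φ t x| ≤ ε := by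
    intro D hD ε hε
    obtain ⟨N, hN⟩ := hCau D hD ε hε
    refine ⟨N, fun k hk t ht x hx => ?_⟩
    refine le_of_tendsto ((tendsto_const_nhds.sub (hφl t x ht)).abs) ?_
    filter_upwards [eventually_ge_atTop N] with m hm
    exact hN k hk m hm t ht x hx
  have hcont : ContinuousOn (fun p : ℝ × PathSp n h T => φ p.1 p.2)
      (Set.Icc 0 T ×ˢ (Set.univ : Set (PathSp n h T))) :=
    cont_limit hT (fun k => continuousOn_iff_lower_upperSemicontinuousOn.2
      ⟨(hφk k).1.2.1, (hφk k).2.2.1⟩) hu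
  have hna : NonAnticipative φ := by
    intro t ht x
    refine tendsto_nhds_unique (hφl t x ht) ((hφl t (stopPath t x) ht).congr fun k => ?_)
    exact ((hφk k).1.1 t ht x).symm
  have hbd : ∀ x, φ T x = σ x := by
    intro x
    refine tendsto_nhds_unique (hφl T x ⟨hT.le, le_rfl⟩) ?_
    rw [Metric.tendsto_atTop]
    intro ε hε
    obtain ⟨N, hN⟩ := hσconv {x} isCompact_singleton (ε / 2) (half_pos hε)
    refine ⟨N, fun k hk => ?_⟩
    have e : φk k T x = σk k x := le_antisymm ((hφk k).2.2.2.1 x) ((hφk k).1.2.2.1 x)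
    rw [Real.dist_eq, e]
    linarith [hN k hk x rfl]
  have hls := continuousOn_iff_lower_upperSemicontinuousOn.1 hcont
  refine ⟨φ, ⟨⟨hna, hls.1, fun x => (hbd x).ge, ?_⟩, ⟨hna, hls.2, fun x => (hbd x).le, ?_⟩⟩, hu⟩
  · intro t ht x s τ hτ
    choose p hp hp' using fun k => (hφk k).1.2.2.2 t ht x s τ hτ
    obtain ⟨q, hq, ψ, hψ, hl⟩ := lim_prop hT hh hH hHk hcconv hHconv hu hcont ht hτ x s p hp
    exact ⟨q, hq, le_of_tendsto_of_tendsto' hl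
      ((hφl t x ⟨ht.1, ht.2.le⟩).comp hψ.tendsto_atTop) (fun j => hp' (ψ j))⟩
  · intro t ht x s τ hτ
    choose p hp hp' using fun k => (hφk k).2.2.2.2 t ht x s τ hτ
    obtain ⟨q, hq, ψ, hψ, hl⟩ := lim_prop hT hh hH hHk hcconv hHconv hu hcont ht hτ x s p hp
    exact ⟨q, hq, le_of_tendsto_of_tendsto'
      ((hφl t x ⟨ht.1, ht.2.le⟩).comp hψ.tendsto_atTop) hl (fun j => hp' (ψ j))⟩

end
end

section
/- Suppose H : [0,T] × C × ℝⁿ → ℝ satisfies conditions (A.1)–(A.5), and for k ∈ ℕ let H_k be the Steklov transform of H in the time variable. Then, for every k ∈ ℕ, H_k satisfies conditions (B.1)–(B.3): (B.1) H_k : [0,T] × C × ℝⁿ → ℝ is continuous; (B.2) for every compact D ⊂ C there exists λ > 0 such that |H_k(t,x₁(·),s) − H_k(t,x₂(·),s)| ≤ λ(1+‖s‖)‖x₁(·∧t) − x₂(·∧t)‖_∞ for all t ∈ [0,T], x₁(·), x₂(·) ∈ D, s ∈ ℝⁿ; (B.3) there exists c > 0 such that |H_k(t,x(·),s₁) − H_k(t,x(·),s₂)|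 ≤ c(1+‖x(·∧t)‖_∞)‖s₁ − s₂‖ for all t ∈ [0,T], x(·) ∈ C, s₁, s₂ ∈ ℝⁿ. -/
open MeasureTheory Set Filter Topology

noncomputable section

attribute [local instance] Classical.propDecidable

lemma aux_ae {T : ℝ} {f g : ℝ → ℝ}
    (hf : AEMeasurable f (volume.restrict (Set.Icc 0 T)))
    (hg : AEMeasurable g (volume.restrict (Set.Icc 0 T)))
    (hE : ∃ E : Set ℝ, E ⊆ Set.Icc 0 T ∧ volume E = ENNReal.ofReal T ∧ ∀ t ∈ E, f t ≤ g t) :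
    ∀ᵐ t ∂(volume.restrict (Set.Icc 0 T)), f t ≤ g t := by
  obtain ⟨E, hE1, hE2, hE3⟩ := hE
  have hS : NullMeasurableSet {t | f t ≤ g t} (volume.restrict (Set.Icc 0 T)) :=
    nullMeasurableSet_le hf hg
  rw [ae_iff]
  have h1 : {t | ¬ f t ≤ g t} = {t | f t ≤ g t}ᶜ := rfl
  rw [h1, measure_compl₀ hS (measure_ne_top _ _)]
  apply tsub_eq_zero_of_le
  have h2 : (volume.restrict (Set.Icc 0 T)) E ≤ (volume.restrict (Set.Icc 0 T)) {t | f t ≤ g t} :=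
    measure_mono hE3
  refine le_trans ?_ h2
  rw [Measure.restrict_apply' (s := Set.Icc 0 T) (t := E) measurableSet_Icc, Set.inter_eq_left.2 hE1, hE2]
  simp

lemma aux_cont_stop {n : ℕ} {h T : ℝ} :
    Continuous (fun p : ℝ × PathSp n h T => stopPath p.1 p.2) := by
  apply ContinuousMap.continuous_of_continuous_uncurry
  have h1 : Continuous (fun q : (ℝ × PathSp n h T) × Set.Icc (-h) T =>
      stopTime h T q.1.1 q.2) := by
    unfold stopTime
    apply Continuous.subtype_mk
    fun_prop
  change Continuous (fun q : (ℝ × PathSp n h T) × Set.Icc (-h) T =>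
      q.1.2 (stopTime h T q.1.1 q.2))
  exact ContinuousEval.continuous_eval.comp ((continuous_snd.comp continuous_fst).prodMk h1)

lemma aux_stop_norm {n : ℕ} {h T : ℝ} (t : ℝ) (x : PathSp n h T) :
    ‖stopPath t x‖ ≤ ‖x‖ := by
  rw [ContinuousMap.norm_le _ (norm_nonneg _)]
  intro τ
  exact ContinuousMap.norm_coe_le_norm x _

lemma aux_stop_sub {n : ℕ} {h T : ℝ} (t : ℝ) (x y : PathSp n h T) :
    ‖stopPath t x - stopPath t y‖ ≤ ‖x - y‖ :=
  aux_stop_norm t (x - y)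

lemma aux_meas {n : ℕ} {h T : ℝ} {H : ℝ → PathSp n h T → Euc n → ℝ} (h1 : CondA1 H)
    (x : PathSp n h T) (s : Euc n) :
    AEMeasurable (fun t => H t x s) (volume.restrict (Set.Icc 0 T)) :=
  aemeasurable_restrict_of_measurable_subtype measurableSet_Icc (h1 x s)

lemma aux_stop_cont_t {n : ℕ} {h T : ℝ} (x : PathSp n h T) :
    Continuous (fun t : ℝ => stopPath t x) :=
  aux_cont_stop.comp (continuous_id.prodMk continuous_const)

lemma aux_A3 {n : ℕ} {h T : ℝ} {H : ℝ → PathSp n h T → Euc n → ℝ} (h1 : CondA1 H)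
    {D : Set (PathSp n h T)} {lam : ℝ → ℝ} (h3 : CondA3For H D lam)
    {x y : PathSp n h T} (hx : x ∈ D) (hy : y ∈ D) (s : Euc n) :
    ∀ᵐ t ∂(volume.restrict (Set.Icc 0 T)),
      |H t x s - H t y s| ≤ lam t * ((1 + ‖s‖) * ‖x - y‖) := by
  have hc : Continuous (fun t : ℝ => ‖stopPath t x - stopPath t y‖) :=
    ((aux_stop_cont_t x).sub (aux_stop_cont_t y)).norm
  have := aux_ae (T := T) (f := fun t => |H t x s - H t y s|)
    (g := fun t => lam t * (1 + ‖s‖) * ‖stopPath t x - stopPath t y‖)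
    ((continuous_abs.measurable).comp_aemeasurable ((aux_meas h1 x s).sub (aux_meas h1 y s)))
    ((h3.1.1.aemeasurable.mul_const _).mul hc.measurable.aemeasurable)
    (h3.2 x hx y hy s)
  filter_upwards [this, ae_restrict_mem measurableSet_Icc] with t ht htm
  refine ht.trans ?_
  rw [mul_assoc]
  have := h3.1.2 t htm
  have := aux_stop_sub t x y
  gcongr

lemma aux_A4 {n : ℕ} {h T : ℝ} {H : ℝ → PathSp n h T → Euc n → ℝ} (h1 : CondA1 H)
    {cH : ℝ → ℝ} (h4 : CondA4 H cH)
    (x : PathSp n h T) (s₁ s₂ : Euc n) :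
    ∀ᵐ t ∂(volume.restrict (Set.Icc 0 T)),
      |H t x s₁ - H t x s₂| ≤ cH t * ((1 + ‖x‖) * ‖s₁ - s₂‖) := by
  have hc : Continuous (fun t : ℝ => 1 + ‖stopPath t x‖) :=
    continuous_const.add (aux_stop_cont_t x).norm
  obtain ⟨E, hE1, hE2, hE3⟩ := h4.2
  have := aux_ae (T := T) (f := fun t => |H t x s₁ - H t x s₂|)
    (g := fun t => cH t * (1 + ‖stopPath t x‖) * ‖s₁ - s₂‖)
    ((continuous_abs.measurable).comp_aemeasurable ((aux_meas h1 x s₁).sub (aux_meas h1 x s₂)))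
    ((h4.1.1.aemeasurable.mul hc.measurable.aemeasurable).mul_const _)
    ⟨E, hE1, hE2, fun t ht => hE3 t ht x s₁ s₂⟩
  filter_upwards [this, ae_restrict_mem measurableSet_Icc] with t ht htm
  refine ht.trans ?_
  rw [mul_assoc]
  have := h4.1.2 t htm
  have := aux_stop_norm t x
  gcongr

lemma aux_int {n : ℕ} {h T : ℝ} {H : ℝ → PathSp n h T → Euc n → ℝ} {cH : ℝ → ℝ}
    (hH : CondA H cH) (x : PathSp n h T) (s : Euc n) :
    IntegrableOn (fun t => H t x s) (Set.Icc 0 T) volume := by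
  obtain ⟨h1, -, -, h4, h5⟩ := hH
  obtain ⟨m, hm, hm2⟩ := h5 {x} isCompact_singleton
  have e5 := aux_ae (T := T) (f := fun t => |H t x 0|) (g := m)
    ((continuous_abs.measurable).comp_aemeasurable (aux_meas h1 x 0)) hm.1.aemeasurable
    (hm2 x rfl)
  have e4 := aux_A4 h1 h4 x s 0
  refine Integrable.mono' (hm.1.add (h4.1.1.mul_const ((1 + ‖x‖) * ‖s - 0‖)))
    (aux_meas h1 x s).aestronglyMeasurable ?_
  filter_upwards [e5, e4] with t h5 h4
  have : H t x s = H t x 0 + (H t x s - H t x 0) := by ring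
  rw [this]
  exact (norm_add_le _ _).trans (add_le_add h5 h4)

/-- Generic estimate of the difference of integrals of extended functions. -/
lemma aux_bound {T : ℝ} {f g c : ℝ → ℝ} {K : ℝ}
    (hf : IntegrableOn f (Set.Icc 0 T) volume) (hg : IntegrableOn g (Set.Icc 0 T) volume)
    (hc : IntegNonneg T c)
    (hb : ∀ᵐ t ∂(volume.restrict (Set.Icc 0 T)), |f t - g t| ≤ c t * K) (a b : ℝ) :
    |(∫ τ in a..b, (Set.Icc 0 T).indicator f τ) - ∫ τ in a..b, (Set.Icc 0 T).indicator g τ|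
      ≤ (∫ τ in Set.Icc 0 T, c τ) * K := by
  have hf' := (integrable_indicator_iff (measurableSet_Icc (a := (0:ℝ)) (b := T))).2 hf
  have hg' := (integrable_indicator_iff (measurableSet_Icc (a := (0:ℝ)) (b := T))).2 hg
  rw [← intervalIntegral.integral_sub hf'.intervalIntegrable hg'.intervalIntegrable]
  rw [← Real.norm_eq_abs]
  refine (intervalIntegral.norm_integral_le_integral_norm_uIoc).trans ?_
  refine (setIntegral_le_integral (hf'.sub hg').norm
    (Eventually.of_forall fun _ => norm_nonneg _)).trans ?_
  rw [← integral_mul_const, ← integral_indicator measurableSet_Icc]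
  refine integral_mono_ae (hf'.sub hg').norm
    ((integrable_indicator_iff measurableSet_Icc).2 (hc.1.mul_const K)) ?_
  rw [ae_restrict_iff' measurableSet_Icc] at hb
  filter_upwards [hb] with t ht
  by_cases htm : t ∈ Set.Icc 0 T
  · simpa [Set.indicator_of_mem htm] using ht htm
  · simp [Set.indicator_of_notMem htm]

/-- The window integral. -/
def auxJ {n : ℕ} {h T : ℝ} (H : ℝ → PathSp n h T → Euc n → ℝ) (a b : ℝ)
    (y : PathSp n h T) (s : Euc n) : ℝ :=
  ∫ τ in a..b, (Set.Icc 0 T).indicator (fun τ => H τ y s) τ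

lemma aux_steklov {n : ℕ} {h T : ℝ} (H : ℝ → PathSp n h T → Euc n → ℝ) (k : ℕ)
    (t : ℝ) (x : PathSp n h T) (s : Euc n) :
    steklov H k t x s =
      ((k : ℝ) / 2) * auxJ H (t - (k : ℝ)⁻¹) (t + (k : ℝ)⁻¹) (stopPath t x) s := by
  unfold steklov auxJ
  congr 2
  funext τ
  by_cases hτ : τ ∈ Set.Icc 0 T
  · rw [if_pos hτ, Set.indicator_of_mem hτ]
  · rw [if_neg hτ, Set.indicator_of_notMem hτ]

lemma aux_J3 {n : ℕ} {h T : ℝ} {H : ℝ → PathSp n h T → Euc n → ℝ} {cH : ℝ → ℝ}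
    (hH : CondA H cH) {D : Set (PathSp n h T)} (hD : IsCompact D) :
    ∃ L : ℝ, 0 ≤ L ∧ ∀ x ∈ D, ∀ y ∈ D, ∀ s a b,
      |auxJ H a b x s - auxJ H a b y s| ≤ L * ((1 + ‖s‖) * ‖x - y‖) := by
  obtain ⟨lam, hl⟩ := hH.2.2.1 D hD
  refine ⟨∫ τ in Set.Icc 0 T, lam τ, setIntegral_nonneg measurableSet_Icc hl.1.2, ?_⟩
  intro x hx y hy s a b
  exact aux_bound (aux_int hH x s) (aux_int hH y s) hl.1 (aux_A3 hH.1 hl hx hy s) a b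

lemma aux_J4 {n : ℕ} {h T : ℝ} {H : ℝ → PathSp n h T → Euc n → ℝ} {cH : ℝ → ℝ}
    (hH : CondA H cH) :
    ∃ C : ℝ, 0 ≤ C ∧ ∀ x s₁ s₂ a b,
      |auxJ H a b x s₁ - auxJ H a b x s₂| ≤ C * ((1 + ‖x‖) * ‖s₁ - s₂‖) := by
  have h4 := hH.2.2.2.1
  refine ⟨∫ τ in Set.Icc 0 T, cH τ, setIntegral_nonneg measurableSet_Icc h4.1.2, ?_⟩
  intro x s₁ s₂ a b
  exact aux_bound (aux_int hH x s₁) (aux_int hH x s₂) h4.1 (aux_A4 hH.1 h4 x s₁ s₂) a b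

lemma aux_Jt {n : ℕ} {h T : ℝ} {H : ℝ → PathSp n h T → Euc n → ℝ} {cH : ℝ → ℝ}
    (hH : CondA H cH) (y : PathSp n h T) (s : Euc n) (r : ℝ) :
    Continuous (fun t => auxJ H (t - r) (t + r) y s) := by
  have hf' := (integrable_indicator_iff (measurableSet_Icc (a := (0:ℝ)) (b := T))).2
    (aux_int hH y s)
  have hp := intervalIntegral.continuous_primitive
    (fun a b => hf'.intervalIntegrable (a := a) (b := b)) 0
  have : (fun t => auxJ H (t - r) (t + r) y s) = fun t =>
      (∫ τ in (0:ℝ)..(t + r), (Set.Icc 0 T).indicator (fun τ => H τ y s) τ) -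
      ∫ τ in (0:ℝ)..(t - r), (Set.Icc 0 T).indicator (fun τ => H τ y s) τ := by
    funext t
    rw [intervalIntegral.integral_interval_sub_left hf'.intervalIntegrable
      hf'.intervalIntegrable]
    rfl
  rw [this]
  exact (hp.comp (continuous_id.add continuous_const)).sub
    (hp.comp (continuous_id.sub continuous_const))

lemma aux_Jcont {n : ℕ} {h T : ℝ} {H : ℝ → PathSp n h T → Euc n → ℝ} {cH : ℝ → ℝ}
    (hH : CondA H cH) (r : ℝ) :
    Continuous (fun p : ℝ × PathSp n h T × Euc n =>
      auxJ H (p.1 - r) (p.1 + r) p.2.1 p.2.2) := by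
  rw [continuous_iff_seqContinuous]
  intro u p hu
  have ht : Tendsto (fun j => (u j).1) atTop (𝓝 p.1) := (continuous_fst.tendsto p).comp hu
  have hy : Tendsto (fun j => (u j).2.1) atTop (𝓝 p.2.1) :=
    ((continuous_fst.comp continuous_snd).tendsto p).comp hu
  have hs : Tendsto (fun j => (u j).2.2) atTop (𝓝 p.2.2) :=
    ((continuous_snd.comp continuous_snd).tendsto p).comp hu
  obtain ⟨C, hC, hC'⟩ := aux_J4 hH
  obtain ⟨L, hL, hL'⟩ := aux_J3 hH hy.isCompact_insert_range
  have l1 : Tendsto (fun j => C * ((1 + ‖(u j).2.1‖) * ‖(u j).2.2 - p.2.2‖)) atTop (𝓝 0) := by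
    have := ((hy.norm.const_add 1).mul (hs.sub_const p.2.2).norm).const_mul C
    simpa using this
  have l2 : Tendsto (fun j => L * ((1 + ‖p.2.2‖) * ‖(u j).2.1 - p.2.1‖)) atTop (𝓝 0) := by
    have := (((hy.sub_const p.2.1).norm).const_mul (1 + ‖p.2.2‖)).const_mul L
    simpa using this
  have l3 : Tendsto (fun j => auxJ H ((u j).1 - r) ((u j).1 + r) p.2.1 p.2.2) atTop
      (𝓝 (auxJ H (p.1 - r) (p.1 + r) p.2.1 p.2.2)) :=
    ((aux_Jt hH p.2.1 p.2.2 r).tendsto p.1).comp ht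
  have l4 : Tendsto (fun j => auxJ H ((u j).1 - r) ((u j).1 + r) (u j).2.1 (u j).2.2 -
      auxJ H ((u j).1 - r) ((u j).1 + r) p.2.1 p.2.2) atTop (𝓝 0) := by
    refine squeeze_zero_norm (fun j => ?_) (by simpa using l1.add l2)
    rw [Real.norm_eq_abs]
    refine (abs_sub_le _ (auxJ H ((u j).1 - r) ((u j).1 + r) (u j).2.1 p.2.2) _).trans ?_
    exact add_le_add (hC' _ _ _ _ _)
      (hL' _ (Set.mem_insert_of_mem _ ⟨j, rfl⟩) _ (Set.mem_insert _ _) _ _ _)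
  simpa [Function.comp_def] using l4.add l3

/-- Lemma on the Steklov transform: each Steklov average
`H_k` of a Hamiltonian satisfying (A.1)–(A.5) satisfies (B.1)–(B.3). -/
theorem stmt15 {n : ℕ} {h T : ℝ} (hT : 0 < T) (hh : 0 ≤ h)
    (H : ℝ → PathSp n h T → Euc n → ℝ) (cH : ℝ → ℝ) (hH : CondA H cH)
    (k : ℕ) (hk : 1 ≤ k) :
    ContinuousOn
      (fun p : ℝ × PathSp n h T × Euc n => steklov H k p.1 p.2.1 p.2.2)
      (Set.Icc 0 T ×ˢ (Set.univ : Set (PathSp n h T × Euc n))) ∧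
    (∀ D : Set (PathSp n h T), IsCompact D → ∃ lam : ℝ, 0 < lam ∧
      ∀ t ∈ Set.Icc (0:ℝ) T, ∀ x₁ ∈ D, ∀ x₂ ∈ D, ∀ s : Euc n,
        |steklov H k t x₁ s - steklov H k t x₂ s| ≤
          lam * (1 + ‖s‖) * ‖stopPath t x₁ - stopPath t x₂‖) ∧
    (∃ c : ℝ, 0 < c ∧ ∀ t ∈ Set.Icc (0:ℝ) T, ∀ x : PathSp n h T,
      ∀ s₁ s₂ : Euc n,
        |steklov H k t x s₁ - steklov H k t x s₂| ≤
          c * (1 + ‖stopPath t x‖) * ‖s₁ - s₂‖) := by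
  refine ⟨?_, ?_, ?_⟩
  · apply Continuous.continuousOn
    simp only [aux_steklov]
    refine continuous_const.mul ((aux_Jcont hH (k : ℝ)⁻¹).comp
      (f := fun p : ℝ × PathSp n h T × Euc n => (p.1, stopPath p.1 p.2.1, p.2.2)) ?_)
    exact continuous_fst.prodMk ((aux_cont_stop.comp
      (continuous_fst.prodMk (continuous_fst.comp continuous_snd))).prodMk
      (continuous_snd.comp continuous_snd))
  · intro D hD
    obtain ⟨L, hL, hL'⟩ := aux_J3 hH
      (((isCompact_Icc (a := (0:ℝ)) (b := T)).prod hD).image aux_cont_stop)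
    refine ⟨(k : ℝ) / 2 * L + 1, by positivity, ?_⟩
    intro t ht x₁ hx₁ x₂ hx₂ s
    rw [aux_steklov, aux_steklov, ← mul_sub, abs_mul, abs_of_nonneg (by positivity)]
    have h1 := hL' _ ⟨(t, x₁), ⟨ht, hx₁⟩, rfl⟩ _ ⟨(t, x₂), ⟨ht, hx₂⟩, rfl⟩ s
      (t - (k : ℝ)⁻¹) (t + (k : ℝ)⁻¹)
    have h2 := mul_le_mul_of_nonneg_left h1 (by positivity : (0:ℝ) ≤ (k : ℝ) / 2)
    refine h2.trans ?_
    have : 0 ≤ (1 + ‖s‖) * ‖stopPath t x₁ - stopPath t x₂‖ := by positivity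
    dsimp only
    linarith
  · obtain ⟨C, hC, hC'⟩ := aux_J4 hH
    refine ⟨(k : ℝ) / 2 * C + 1, by positivity, ?_⟩
    intro t ht x s₁ s₂
    rw [aux_steklov, aux_steklov, ← mul_sub, abs_mul, abs_of_nonneg (by positivity)]
    have h1 := hC' (stopPath t x) s₁ s₂ (t - (k : ℝ)⁻¹) (t + (k : ℝ)⁻¹)
    have h2 := mul_le_mul_of_nonneg_left h1 (by positivity : (0:ℝ) ≤ (k : ℝ) / 2)
    refine h2.trans ?_
    have : 0 ≤ (1 + ‖stopPath t x‖) * ‖s₁ - s₂‖ := by positivity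
    linarith

end
end
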